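/- arXiv:1703.01695 — 5 statements merged into one kernel-verified Lean document; each statement's English description precedes it below -/
import Mathlib

section
/- Let M be a nonempty closed subset of ℝ. Then the following are equivalent: (i) any two self-adjoint operators A, B on H with σ_ess(A) = σ_ess(B) = M are Weyl–von Neumann equivalent; (ii) M has no large holes at infinity. -/
open Filter Metric Topology LinearPMap

noncomputable section

variable {H : Type*} [NormedAddCommGroup H] [InnerProductSpace ℂ H] [CompleteSpace H]

/-- A (possibly unbounded) self-adjoint operator: densely defined and equal to its adjoint. -/
def IsSelfAdjointOp (A : H →ₗ.[ℂ] H) : Prop :=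
  Dense (A.domain : Set H) ∧ A.adjoint = A

/-- The essential spectrum of a (partially defined) operator: the set of real `t` admitting an
orthonormal sequence in the domain along which `‖A xₙ - t • xₙ‖ → 0`. -/
def essSpec (A : H →ₗ.[ℂ] H) : Set ℝ :=
  {t | ∃ x : ℕ → A.domain, Orthonormal ℂ (fun n => (x n : H)) ∧
    Tendsto (fun n => ‖A (x n) - (t : ℂ) • (x n : H)‖) atTop (𝓝 0)}

/-- Weyl–von Neumann equivalence: `u A u* + K = B` for some unitary `u` and
compact self-adjoint `K`. -/
def WvNEquiv (A B : H →ₗ.[ℂ] H) : Prop :=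
  ∃ (u : H ≃ₗᵢ[ℂ] H) (K : H →L[ℂ] H), IsCompactOperator K ∧ IsSelfAdjoint K ∧
    B.domain = A.domain.map (u.toLinearEquiv : H →ₗ[ℂ] H) ∧
    ∀ (x : A.domain) (hx : u (x : H) ∈ B.domain), B ⟨u (x : H), hx⟩ = u (A x) + K (u (x : H))

/-- `M` has no large holes at infinity. -/
def NoLargeHoles (M : Set ℝ) : Prop :=
  M.Nonempty ∧ ∀ ε > 0, ∃ N > 0, ∀ l : ℝ, l ∉ M → |l| > N → infDist l M < ε

end

section BoundedOperators

variable {H : Type*} [NormedAddCommGroup H] [InnerProductSpace ℂ H] [CompleteSpace H]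

/-- The sign of a bounded self-adjoint operator, as a self-adjoint involution in its
bicommutant. -/
theorem exists_sign_of_isSelfAdjoint {T : H →L[ℂ] H} (hT : IsSelfAdjoint T) {L : ℝ}
    (hL : ‖T‖ ≤ L) :
    ∃ s : H →L[ℂ] H, IsSelfAdjoint s ∧ s * s = 1 ∧ ‖T - (L / 2 : ℝ) • s‖ ≤ L / 2 ∧
      ∀ C : H →L[ℂ] H, IsSelfAdjoint C → Commute C T → Commute C s := by
  set p : H →L[ℂ] H := cfc (fun t : ℝ => max t 0) T with hp
  set m : H →L[ℂ] H := cfc (fun t : ℝ => max (-t) 0) T with hm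
  have hpc : ContinuousOn (fun t : ℝ => max t 0) (spectrum ℝ T) := by fun_prop
  have hmc : ContinuousOn (fun t : ℝ => max (-t) 0) (spectrum ℝ T) := by fun_prop
  have hpm : p * m = 0 := by
    rw [hp, hm, ← cfc_mul _ _ T, ← cfc_zero ℝ T]
    congr 1; funext t
    rcases le_total t 0 with h | h <;> simp [h]
  have hmp : m * p = 0 := by
    rw [hp, hm, ← cfc_mul _ _ T, ← cfc_zero ℝ T]
    congr 1; funext t
    rcases le_total t 0 with h | h <;> simp [h]
  have hsub : p - m = T := by
    rw [hp, hm, ← cfc_sub _ _ T]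
    conv_rhs => rw [← cfc_id ℝ T]
    congr 1; funext t
    rcases le_total t 0 with h | h <;> simp [h]
  have habs : ‖p + m - algebraMap ℝ (H →L[ℂ] H) (L / 2)‖ ≤ L / 2 := by
    have hL0 : 0 ≤ L := (norm_nonneg _).trans hL
    have hEq : p + m - algebraMap ℝ (H →L[ℂ] H) (L / 2) =
        cfc (fun t : ℝ => max t 0 + max (-t) 0 - L / 2) T := by
      rw [cfc_sub (fun t : ℝ => max t 0 + max (-t) 0) (fun _ => L / 2) T, cfc_add T (fun t : ℝ => max t 0) (fun t => max (-t) 0),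
        cfc_const (L / 2) T]
    rw [hEq]
    refine norm_cfc_le (by positivity) fun t ht => ?_
    have ht' : |t| ≤ L := by
      refine (spectrum.norm_le_norm_mul_of_mem ht).trans (le_trans ?_ hL)
      exact mul_le_of_le_one_right (norm_nonneg _) ContinuousLinearMap.norm_id_le
    rw [abs_le] at ht'
    rw [Real.norm_eq_abs, abs_le]
    rcases le_total t 0 with h | h <;> simp only [h, max_eq_left, max_eq_right, neg_nonneg,
      neg_nonpos] <;> constructor <;> linarith
  have hp_sa : IsSelfAdjoint p := IsSelfAdjoint.cfc
  let U : Submodule ℂ H := LinearMap.ker (p : H →ₗ[ℂ] H)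
  have hUc : IsClosed (U : Set H) := p.isClosed_ker
  have : CompleteSpace U := hUc.completeSpace_coe
  set Q : H →L[ℂ] H := U.starProjection with hQ
  have hQsa : IsSelfAdjoint Q := isSelfAdjoint_starProjection U
  have hQQ : Q * Q = Q := U.isIdempotentElem_starProjection
  have hpQ : p * Q = 0 := by
    ext x
    exact (U.starProjection_apply_mem x : _)
  have hQm : Q * m = m := by
    ext x
    refine Submodule.starProjection_eq_self_iff.2 ?_
    change (p * m) x = 0
    simp [hpm]
  have hQp : Q * p = 0 := by
    have := congrArg star hpQ
    simpa [hQsa.star_eq, hp_sa.star_eq] using this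
  set s : H →L[ℂ] H := 1 - (Q + Q) with hs
  have hs_sa : IsSelfAdjoint s := (IsSelfAdjoint.one _).sub (hQsa.add hQsa)
  have hss : s * s = 1 := by
    simp only [hs, mul_sub, sub_mul, mul_add, add_mul, one_mul, mul_one, hQQ]
    abel
  have hsT : s * (p + m) = T := by
    rw [← hsub]
    simp only [hs, sub_mul, mul_add, add_mul, one_mul, hQm, hQp]
    abel
  refine ⟨s, hs_sa, hss, ?_, fun C hC hCT => ?_⟩
  · have h1 : T - (L / 2 : ℝ) • s = s * (p + m - algebraMap ℝ (H →L[ℂ] H) (L / 2)) := by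
      rw [mul_sub, hsT, Algebra.algebraMap_eq_smul_one, mul_smul_comm, mul_one]
    have h2 : ‖s‖ ≤ 1 := by
      have := CStarRing.norm_star_mul_self (x := s)
      rw [hs_sa.star_eq, hss] at this
      have h3 : ‖(1 : H →L[ℂ] H)‖ ≤ 1 := ContinuousLinearMap.norm_id_le
      nlinarith [norm_nonneg s]
    rw [h1]
    calc _ ≤ ‖s‖ * ‖p + m - algebraMap ℝ (H →L[ℂ] H) (L / 2)‖ := norm_mul_le _ _
      _ ≤ 1 * (L / 2) := by gcongr
      _ = L / 2 := one_mul _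
  · have hCp : Commute C p := (hCT.symm.cfc_real _).symm
    have hCQ' : Q * C * Q = C * Q := by
      ext x
      refine Submodule.starProjection_eq_self_iff.2 ?_
      change (p * C * Q) x = 0
      rw [← hCp.eq, mul_assoc, hpQ, mul_zero]; rfl
    have hCQ : Commute C Q := by
      have := congrArg star hCQ'
      simp only [star_mul, hQsa.star_eq, hC.star_eq, ← mul_assoc] at this
      exact hCQ'.symm.trans this
    exact (Commute.one_right C).sub_right (hCQ.add_right hCQ)

/-- A bounded self-adjoint operator is a norm limit of operators leaving finite-dimensional
enlargements of a given finite-dimensional subspace invariant. -/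
theorem exists_invariant_approx (n : ℕ) : ∀ {T : H →L[ℂ] H} (_ : IsSelfAdjoint T) {L : ℝ}
    (_ : ‖T‖ ≤ L) (W₀ : Submodule ℂ H) [FiniteDimensional ℂ W₀],
    ∃ (W : Submodule ℂ H) (T' : H →L[ℂ] H), FiniteDimensional ℂ W ∧ W₀ ≤ W ∧
      ‖T - T'‖ ≤ L / 2 ^ n ∧ (∀ w ∈ W, T' w ∈ W) ∧
      (∀ C : H →L[ℂ] H, IsSelfAdjoint C → Commute C T → (∀ w ∈ W₀, C w ∈ W₀) →
        ∀ w ∈ W, C w ∈ W) ∧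
      (∀ C : H →L[ℂ] H, IsSelfAdjoint C → Commute C T → (∀ w ∈ W₀, C w = 0) →
        ∀ w ∈ W, C w = 0) := by
  induction n with
  | zero =>
    intro T hT L hL W₀ _
    exact ⟨W₀, 0, inferInstance, le_rfl, by simpa using hL, by simp,
      fun C _ _ h => h, fun C _ _ h => h⟩
  | succ n ih =>
    intro T hT L hL W₀ _
    obtain ⟨s, hs, hss, hTs, hcomm⟩ := exists_sign_of_isSelfAdjoint hT hL
    have hss' : ∀ x, s (s x) = x := fun x => by
      simpa using congrArg (fun f : H →L[ℂ] H => f x) hss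
    obtain ⟨W, T', hfd, hW, hT', hinv, hC1, hC2⟩ :=
      ih (hT.sub ((IsSelfAdjoint.all (L / 2 : ℝ)).smul hs)) hTs
        (W₀ ⊔ W₀.map (s : H →ₗ[ℂ] H))
    have hcomm' : ∀ C : H →L[ℂ] H, IsSelfAdjoint C → Commute C T →
        Commute C (T - (L / 2 : ℝ) • s) := fun C hC hCT =>
      hCT.sub_right ((hcomm C hC hCT).smul_right _)
    have hsW : ∀ w ∈ W, s w ∈ W := by
      refine hC1 s hs ?_ ?_
      · exact ((hcomm T hT (Commute.refl T)).symm).sub_right ((Commute.refl s).smul_right _)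
      · intro w hw
        obtain ⟨a, ha, c, ⟨b, hb, rfl⟩, rfl⟩ := Submodule.mem_sup.1 hw
        rw [_root_.map_add]
        refine add_mem (Submodule.mem_sup_right ⟨a, ha, rfl⟩) (Submodule.mem_sup_left ?_)
        simpa [hss'] using hb
    have hCs : ∀ C : H →L[ℂ] H, IsSelfAdjoint C → Commute C T → ∀ x, C (s x) = s (C x) :=
      fun C hC hCT x => congrArg (fun f : H →L[ℂ] H => f x) (hcomm C hC hCT).eq
    refine ⟨W, T' + (L / 2 : ℝ) • s, hfd, le_sup_left.trans hW, ?_, ?_, ?_, ?_⟩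
    · rw [add_comm, ← sub_sub]
      refine hT'.trans_eq ?_
      rw [pow_succ]; ring
    · intro w hw
      exact add_mem (hinv w hw) ((W.restrictScalars ℝ).smul_mem _ (hsW w hw))
    · intro C hC hCT h
      refine hC1 C hC (hcomm' C hC hCT) fun w hw => ?_
      obtain ⟨a, ha, c, ⟨b, hb, rfl⟩, rfl⟩ := Submodule.mem_sup.1 hw
      rw [_root_.map_add]
      exact add_mem (Submodule.mem_sup_left (h a ha))
        (Submodule.mem_sup_right ⟨C b, h b hb, (hCs C hC hCT b).symm⟩)
    · intro C hC hCT h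
      refine hC2 C hC (hcomm' C hC hCT) fun w hw => ?_
      obtain ⟨a, ha, c, ⟨b, hb, rfl⟩, rfl⟩ := Submodule.mem_sup.1 hw
      have : C ((s : H →ₗ[ℂ] H) b) = s (C b) := hCs C hC hCT b
      rw [_root_.map_add, h a ha, this, h b hb, _root_.map_zero, add_zero]

end BoundedOperators

section Resolvent

variable {H : Type*} [NormedAddCommGroup H] [InnerProductSpace ℂ H] [CompleteSpace H]

theorem IsSelfAdjointOp.inner_apply_left {A : H →ₗ.[ℂ] H} (hA : IsSelfAdjointOp A)
    (x y : A.domain) : inner ℂ (A x) (y : H) = inner ℂ (x : H) (A y) := by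
  have h := A.adjoint_isFormalAdjoint hA.1
  rw [hA.2] at h
  exact h x y

theorem IsSelfAdjointOp.exists_apply_eq {A : H →ₗ.[ℂ] H} (hA : IsSelfAdjointOp A) {y w : H}
    (h : ∀ x : A.domain, inner ℂ w (x : H) = inner ℂ y (A x)) :
    ∃ hy : y ∈ A.domain, A ⟨y, hy⟩ = w := by
  have h1 : y ∈ A.adjoint.domain := A.mem_adjoint_domain_of_exists y ⟨w, h⟩
  have h2 := A.adjoint_apply_eq hA.1 ⟨y, h1⟩ h
  have h3 : A.adjoint ≤ A := hA.2.le
  exact ⟨h3.1 h1, (h3.2 (x := ⟨y, h1⟩) rfl).symm.trans h2⟩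

theorem IsSelfAdjointOp.isClosed {A : H →ₗ.[ℂ] H} (hA : IsSelfAdjointOp A) : A.IsClosed := by
  have := A.adjoint_isClosed hA.1
  rwa [hA.2] at this

theorem IsSelfAdjointOp.eq_zero_of_add_sq {A : H →ₗ.[ℂ] H} (hA : IsSelfAdjointOp A)
    {y : A.domain} (hy : A y ∈ A.domain) (h : (y : H) + A ⟨A y, hy⟩ = 0) : (y : H) = 0 := by
  have h1 := congrArg (inner ℂ (y : H)) h
  rw [inner_add_right, inner_zero_right, ← hA.inner_apply_left y ⟨A y, hy⟩,
    inner_self_eq_norm_sq_to_K, inner_self_eq_norm_sq_to_K] at h1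
  have h2 : ‖(y : H)‖ ^ 2 + ‖A y‖ ^ 2 = 0 :=
    (RCLike.ofReal_eq_zero (K := ℂ)).1 (by push_cast; exact h1)
  have : ‖(y : H)‖ ^ 2 = 0 := by nlinarith [sq_nonneg ‖(y : H)‖, sq_nonneg ‖A y‖]
  simpa using this

/-- Von Neumann's operators `S = (1 + A²)⁻¹` and `B = A (1 + A²)⁻¹`. -/
theorem IsSelfAdjointOp.exists_inv_one_add_sq {A : H →ₗ.[ℂ] H} (hA : IsSelfAdjointOp A) :
    ∃ S B : H →L[ℂ] H, S.IsPositive ∧ IsSelfAdjoint B ∧ Commute S B ∧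
      (∀ z, ∃ h : S z ∈ A.domain, A ⟨S z, h⟩ = B z) ∧
      (∀ z, ∃ h : B z ∈ A.domain, A ⟨B z, h⟩ = z - S z) := by
  let e := WithLp.prodContinuousLinearEquiv 2 ℂ H H
  let G : Submodule ℂ (WithLp 2 (H × H)) := A.graph.comap (e : WithLp 2 (H × H) →ₗ[ℂ] H × H)
  have hG : IsClosed (G : Set (WithLp 2 (H × H))) := hA.isClosed.preimage e.continuous
  have : CompleteSpace G := hG.completeSpace_coe
  let J : H →L[ℂ] WithLp 2 (H × H) :=
    (e.symm : H × H →L[ℂ] WithLp 2 (H × H)) ∘L ContinuousLinearMap.inl ℂ H H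
  let R : H →L[ℂ] H × H := (e : WithLp 2 (H × H) →L[ℂ] H × H) ∘L G.starProjection ∘L J
  let S : H →L[ℂ] H := ContinuousLinearMap.fst ℂ H H ∘L R
  let B : H →L[ℂ] H := ContinuousLinearMap.snd ℂ H H ∘L R
  have hS : ∀ z, ∃ h : S z ∈ A.domain, A ⟨S z, h⟩ = B z := by
    intro z
    have h : R z ∈ A.graph := G.starProjection_apply_mem (J z)
    obtain ⟨y, hy1, hy2⟩ := (LinearPMap.mem_graph_iff A).1 h
    have h1 : S z = y := hy1.symm
    have h2 : B z = A y := hy2.symm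
    exact ⟨h1 ▸ y.2, by rw [h2]; congr 1; exact Subtype.ext h1⟩
  have hB : ∀ z, ∃ h : B z ∈ A.domain, A ⟨B z, h⟩ = z - S z := by
    intro z
    refine hA.exists_apply_eq fun x => ?_
    have hx : e.symm ((x : H), A x) ∈ G := by
      change e (e.symm ((x : H), A x)) ∈ A.graph
      rw [ContinuousLinearEquiv.apply_symm_apply]
      exact A.mem_graph x
    have h := G.starProjection_inner_eq_zero (J z) _ hx
    rw [WithLp.prod_inner_apply] at h
    have h' : inner ℂ (z - S z) (x : H) + inner ℂ (0 - B z) (A x) = 0 := h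
    rw [zero_sub, inner_neg_left] at h'
    linear_combination h'
  have hinner : ∀ z z', inner ℂ (S z) z' = inner ℂ (S z) (S z') + inner ℂ (B z) (B z') := by
    intro z z'
    obtain ⟨h1, h1'⟩ := hS z
    obtain ⟨h2, h2'⟩ := hB z'
    have := hA.inner_apply_left ⟨S z, h1⟩ ⟨B z', h2⟩
    rw [h1', h2', inner_sub_right] at this
    simp only at this
    linear_combination -this
  have hinner' : ∀ z z', inner ℂ z (S z') = inner ℂ (S z) (S z') + inner ℂ (B z) (B z') := by
    intro z z'
    rw [← inner_conj_symm, hinner z' z, _root_.map_add, inner_conj_symm, inner_conj_symm]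
  have huniq : ∀ (z : H) (y : A.domain) (hy : A y ∈ A.domain),
      (y : H) + A ⟨A y, hy⟩ = z → (y : H) = S z := by
    intro z y hy h
    obtain ⟨h1, h1'⟩ := hS z
    obtain ⟨h2, h2'⟩ := hB z
    have h3 : A (y - ⟨S z, h1⟩) = A y - B z := by rw [LinearPMap.map_sub, h1']
    have h4 : A (y - ⟨S z, h1⟩) ∈ A.domain := h3 ▸ sub_mem hy h2
    refine sub_eq_zero.1 (hA.eq_zero_of_add_sq (y := y - ⟨S z, h1⟩) h4 ?_)
    have h5 : A ⟨A (y - ⟨S z, h1⟩), h4⟩ = A ⟨A y, hy⟩ - A ⟨B z, h2⟩ := by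
      rw [← LinearPMap.map_sub]
      congr 1
      exact Subtype.ext h3
    rw [h5, h2']
    calc _ = ((y : H) + A ⟨A y, hy⟩) - z := by rw [Submodule.coe_sub]; abel
      _ = 0 := sub_eq_zero.2 h
  refine ⟨S, B, ?_, ?_, ?_, hS, hB⟩
  · refine ⟨fun z z' => (hinner z z').trans (hinner' z z').symm, fun z => ?_⟩
    have := hinner z z
    rw [ContinuousLinearMap.reApplyInnerSelf_apply, this, _root_.map_add]
    exact add_nonneg inner_self_nonneg inner_self_nonneg
  · rw [ContinuousLinearMap.isSelfAdjoint_iff_isSymmetric]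
    intro z z'
    obtain ⟨h1, h1'⟩ := hS z
    obtain ⟨h2, h2'⟩ := hB z
    obtain ⟨h3, h3'⟩ := hS z'
    obtain ⟨h4, h4'⟩ := hB z'
    have e2 := hA.inner_apply_left ⟨S z, h1⟩ ⟨S z', h3⟩
    have e3 := hA.inner_apply_left ⟨B z, h2⟩ ⟨B z', h4⟩
    simp only [h1', h2', h3', h4', inner_sub_left, inner_sub_right] at e2 e3
    change inner ℂ (B z) z' = inner ℂ z (B z')
    linear_combination e2 - e3
  · ext z
    change S (B z) = B (S z)
    obtain ⟨h1, h1'⟩ := hS z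
    obtain ⟨h2, h2'⟩ := hB z
    obtain ⟨h3, h3'⟩ := hS (S z)
    obtain ⟨h4, h4'⟩ := hB (S z)
    have h5 : A ⟨B (S z), h4⟩ ∈ A.domain := h4' ▸ sub_mem h1 h3
    refine (huniq (B z) ⟨B (S z), h4⟩ h5 ?_).symm
    have h6 : A ⟨A ⟨B (S z), h4⟩, h5⟩ = A ⟨S z, h1⟩ - A ⟨S (S z), h3⟩ := by
      rw [← LinearPMap.map_sub]
      congr 1
      exact Subtype.ext h4'
    rw [h6, h1', h3']
    simp

end Resolvent

section Core

variable {H : Type*} [NormedAddCommGroup H] [InnerProductSpace ℂ H] [CompleteSpace H]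

/-- The spectral subspace of a bounded self-adjoint operator `S` for `[η, ∞)`. -/
noncomputable def upperSpectralSubspace (S : H →L[ℂ] H) (η : ℝ) : Submodule ℂ H :=
  LinearMap.ker ((cfc (fun s : ℝ => max (η - s) 0) S : H →L[ℂ] H) : H →ₗ[ℂ] H)

theorem mem_upperSpectralSubspace {S : H →L[ℂ] H} {η : ℝ} {x : H} :
    x ∈ upperSpectralSubspace S η ↔ cfc (fun s : ℝ => max (η - s) 0) S x = 0 := Iff.rfl

theorem upperSpectralSubspace_anti {S : H →L[ℂ] H} {η η' : ℝ}
    (h : η' ≤ η) : upperSpectralSubspace S η ≤ upperSpectralSubspace S η' := by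
  rcases h.eq_or_lt with rfl | h
  · exact le_rfl
  intro x hx
  rw [mem_upperSpectralSubspace] at hx ⊢
  have hk : Continuous fun s : ℝ => max (η' - s) 0 / max (η - s) (η - η') := by
    refine Continuous.div (by fun_prop) (by fun_prop) fun s => ?_
    exact (lt_max_of_lt_right (sub_pos.2 h)).ne'
  have heq : cfc (fun s : ℝ => max (η' - s) 0) S =
      cfc (fun s : ℝ => max (η' - s) 0 / max (η - s) (η - η')) S *
        cfc (fun s : ℝ => max (η - s) 0) S := by
    rw [← cfc_mul _ _ S hk.continuousOn]
    congr 1; funext s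
    rcases le_total s η' with hs | hs
    · rw [max_eq_left (by linarith : η - η' ≤ η - s), max_eq_left (by linarith : 0 ≤ η - s),
        div_mul_cancel₀ _ (by linarith : η - s ≠ 0)]
    · rw [max_eq_right (by linarith : η' - s ≤ 0), zero_div, zero_mul]
  rw [heq, mul_apply_eq_comp, hx, _root_.map_zero]

/-- A reducing subspace on which `A` agrees with a bounded self-adjoint operator. -/
theorem exists_bounded_agreeing {A : H →ₗ.[ℂ] H} {S B : H →L[ℂ] H} (hS : IsSelfAdjoint S)
    (hB : IsSelfAdjoint B) (hSB : Commute S B)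
    (hSA : ∀ z, ∃ h : S z ∈ A.domain, A ⟨S z, h⟩ = B z) {η : ℝ} (hη : 0 < η) :
    ∃ T : H →L[ℂ] H, IsSelfAdjoint T ∧ Commute (cfc (fun s : ℝ => max (η - s) 0) S) T ∧
      ∀ v ∈ upperSpectralSubspace S η, ∃ h : v ∈ A.domain, A ⟨v, h⟩ = T v := by
  have hgc : Continuous fun s : ℝ => (max s η)⁻¹ :=
    Continuous.inv₀ (by fun_prop) fun s => (lt_max_of_lt_right hη).ne'
  set G : H →L[ℂ] H := cfc (fun s : ℝ => (max s η)⁻¹) S with hG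
  set N : H →L[ℂ] H := cfc (fun s : ℝ => max (η - s) 0) S with hN
  have hGB : Commute G B := hSB.cfc_real _
  have hNB : Commute N B := hSB.cfc_real _
  have hNG : Commute N G := cfc_commute_cfc _ _ S
  have hGsa : IsSelfAdjoint G := IsSelfAdjoint.cfc
  have hSG : S * G = 1 - G * N := by
    have h1 : S * G = cfc (fun s : ℝ => s * (max s η)⁻¹) S := by
      rw [cfc_mul _ _ S (by fun_prop) hgc.continuousOn, cfc_id' ℝ S]
    have h2 : G * N = cfc (fun s : ℝ => (max s η)⁻¹ * max (η - s) 0) S := by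
      rw [cfc_mul _ _ S hgc.continuousOn]
    rw [h1, h2, ← cfc_const_one ℝ S, ← cfc_sub (R := ℝ) (fun _ => 1)
      (fun s => (max s η)⁻¹ * max (η - s) 0) S (by fun_prop)
      (hgc.mul (by fun_prop)).continuousOn]
    congr 1; funext s
    have : max s η ≠ 0 := (lt_max_of_lt_right hη).ne'
    field_simp
    rcases le_total s η with hs | hs
    · rw [max_eq_right hs, max_eq_left (by linarith : 0 ≤ η - s)]; ring
    · rw [max_eq_left hs, max_eq_right (by linarith : η - s ≤ 0)]; ring
  refine ⟨B * G, ?_, hNB.mul_right hNG, fun v hv => ?_⟩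
  · rw [IsSelfAdjoint, star_mul, hB.star_eq, hGsa.star_eq, hGB.eq]
  · obtain ⟨h, h'⟩ := hSA (G v)
    have hv' : N v = 0 := hv
    have hSGv : S (G v) = v := by
      have := congrArg (fun f : H →L[ℂ] H => f v) hSG
      simpa [hv'] using this
    refine ⟨hSGv ▸ h, Eq.trans ?_ h'⟩
    congr 1
    exact Subtype.ext hSGv.symm

/-- A self-adjoint operator admits a dense subspace of its domain in which finite-dimensional
subspaces can be enlarged to almost invariant finite-dimensional subspaces. -/
theorem IsSelfAdjointOp.exists_core {A : H →ₗ.[ℂ] H} (hA : IsSelfAdjointOp A) :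
    ∃ X : Submodule ℂ H, X ≤ A.domain ∧ Dense (X : Set H) ∧
      ∀ W₀ : Submodule ℂ H, W₀ ≤ X → FiniteDimensional ℂ W₀ → ∀ ε > 0,
        ∃ W : Submodule ℂ H, FiniteDimensional ℂ W ∧ W₀ ≤ W ∧ W ≤ X ∧
          ∀ w : A.domain, (w : H) ∈ W → ∃ v ∈ W, ‖A w - v‖ ≤ ε * ‖(w : H)‖ := by
  obtain ⟨S, B, hSpos, hB, hSB, hSA, hBA⟩ := hA.exists_inv_one_add_sq
  have hS : IsSelfAdjoint S := hSpos.isSelfAdjoint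
  let η : ℕ → ℝ := fun n => 1 / ((n : ℝ) + 1)
  have hη : ∀ n, 0 < η n := fun n => Nat.one_div_pos_of_nat
  let V : ℕ → Submodule ℂ H := fun n => upperSpectralSubspace S (η n)
  have hV : Monotone V := fun m n hmn =>
    upperSpectralSubspace_anti (Nat.one_div_le_one_div hmn)
  choose T hT hNT hTA using fun n => exists_bounded_agreeing hS hB hSB hSA (hη n)
  have hVdir : Directed (· ≤ ·) V := hV.directed_le
  refine ⟨⨆ n, V n, iSup_le fun n v hv => (hTA n v hv).1, ?_, ?_⟩
  · intro f
    have hran : Dense (Set.range S) := by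
      change Dense ((LinearMap.range (S : H →ₗ[ℂ] H) : Submodule ℂ H) : Set H)
      rw [Submodule.dense_iff_topologicalClosure_eq_top,
        Submodule.topologicalClosure_eq_top_iff, Submodule.eq_bot_iff]
      intro z hz
      have hSz : S z = 0 := by
        rw [← inner_self_eq_zero (𝕜 := ℂ)]
        refine (hSpos.1 z (S z)).trans ?_
        have := (Submodule.mem_orthogonal _ _).1 hz (S (S z)) ⟨S z, rfl⟩
        exact inner_eq_zero_symm.1 this
      obtain ⟨h1, h1'⟩ := hSA z
      obtain ⟨h2, h2'⟩ := hBA z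
      have hBz : B z = 0 := by
        rw [← h1', show (⟨S z, h1⟩ : A.domain) = 0 from Subtype.ext hSz, LinearPMap.map_zero]
      rw [show (⟨B z, h2⟩ : A.domain) = 0 from Subtype.ext hBz, LinearPMap.map_zero, hSz,
        sub_zero] at h2'
      exact h2'.symm
    refine closure_minimal (s := Set.range S) ?_ isClosed_closure (hran f)
    rintro _ ⟨x, rfl⟩
    have hbound : ∀ n, ‖S - cfc (fun s : ℝ => max (s - η n) 0) S‖ ≤ η n := by
      intro n
      conv_lhs => rw [← cfc_id' ℝ S]
      rw [cfc_id' ℝ S]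
      have : S - cfc (fun s : ℝ => max (s - η n) 0) S =
          cfc (fun s : ℝ => s - max (s - η n) 0) S := by
        rw [cfc_sub (fun s : ℝ => s) _ S, cfc_id' ℝ S]
      rw [this]
      refine norm_cfc_le (hη n).le fun s hs => ?_
      have hs0 : 0 ≤ s := spectrum_nonneg_of_nonneg
        ((ContinuousLinearMap.nonneg_iff_isPositive S).2 hSpos) hs
      rw [Real.norm_eq_abs, abs_le]
      have := hη n
      rcases le_total s (η n) with h | h
      · rw [max_eq_right (by linarith)]; constructor <;> linarith
      · rw [max_eq_left (by linarith)]; constructor <;> linarith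
    have hlim : Tendsto (fun n => cfc (fun s : ℝ => max (s - η n) 0) S x) atTop (𝓝 (S x)) := by
      rw [tendsto_iff_norm_sub_tendsto_zero]
      have h0 : Tendsto (fun n => η n * ‖x‖) atTop (𝓝 0) := by
        simpa only [zero_mul] using tendsto_one_div_add_atTop_nhds_zero_nat.mul_const ‖x‖
      refine squeeze_zero (fun _ => norm_nonneg _) (fun n => ?_) h0
      rw [norm_sub_rev, ← _root_.sub_apply]
      exact (ContinuousLinearMap.le_opNorm _ _).trans
        (mul_le_mul_of_nonneg_right (hbound n) (norm_nonneg _))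
    refine mem_closure_of_tendsto hlim (Eventually.of_forall fun n => ?_)
    refine Submodule.mem_iSup_of_mem n ?_
    change (cfc (fun s : ℝ => max (η n - s) 0) S * cfc (fun s : ℝ => max (s - η n) 0) S) x = 0
    rw [← cfc_mul _ _ S]
    have : (fun s : ℝ => max (η n - s) 0 * max (s - η n) 0) = fun _ => 0 := by
      funext s
      rcases le_total s (η n) with h | h
      · rw [max_eq_right (by linarith : s - η n ≤ 0), mul_zero]
      · rw [max_eq_right (by linarith : η n - s ≤ 0), zero_mul]
    rw [this, cfc_const_zero ℝ S]; rfl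
  · intro W₀ hW₀ hfd ε hε
    obtain ⟨n, hn⟩ : ∃ n, W₀ ≤ V n := by
      have hc := (Submodule.fg_iff_compact W₀).1 ((Submodule.fg_iff_finiteDimensional W₀).2 hfd)
      obtain ⟨_, ⟨n, rfl⟩, hn⟩ := hc (Set.range V) _ (Set.range_nonempty V)
        hVdir.directedOn_range (isLUB_iSup (f := V)) hW₀
      exact ⟨n, hn⟩
    obtain ⟨k, hk⟩ : ∃ k : ℕ, ‖T n‖ / 2 ^ k ≤ ε := by
      obtain ⟨k, hk⟩ := pow_unbounded_of_one_lt (‖T n‖ / ε) (one_lt_two)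
      refine ⟨k, ?_⟩
      rw [div_lt_iff₀ hε] at hk
      rw [div_le_iff₀ (by positivity)]
      linarith
    obtain ⟨W, T', hWfd, hWW, hTT', hT'W, -, hker⟩ :=
      exists_invariant_approx k (hT n) le_rfl W₀
    have hWV : W ≤ V n := fun w hw =>
      hker _ IsSelfAdjoint.cfc (hNT n) (fun w hw => hn hw) w hw
    refine ⟨W, hWfd, hWW, hWV.trans (le_iSup V n), fun w hw => ⟨T' w, hT'W _ hw, ?_⟩⟩
    obtain ⟨h, h'⟩ := hTA n w (hWV hw)
    have : A w = T n w := h'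
    rw [this, ← _root_.sub_apply]
    exact (ContinuousLinearMap.le_opNorm _ _).trans
      (mul_le_mul_of_nonneg_right (hTT'.trans hk) (norm_nonneg _))

end Core

section Chain

variable {H : Type*} [NormedAddCommGroup H] [InnerProductSpace ℂ H] [CompleteSpace H]
  [TopologicalSpace.SeparableSpace H]

/-- An exhausting chain of increasingly invariant finite-dimensional subspaces of the domain. -/
theorem IsSelfAdjointOp.exists_chain {A : H →ₗ.[ℂ] H} (hA : IsSelfAdjointOp A) :
    ∃ W : ℕ → Submodule ℂ H, W 0 = ⊥ ∧ Monotone W ∧ (∀ n, FiniteDimensional ℂ (W n)) ∧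
      (∀ n, W n ≤ A.domain) ∧ Dense ((⨆ n, W n : Submodule ℂ H) : Set H) ∧
      ∀ n, ∀ w : A.domain, (w : H) ∈ W (n + 1) →
        ∃ v ∈ W (n + 1), ‖A w - v‖ ≤ (1 / 2) ^ n * ‖(w : H)‖ := by
  obtain ⟨X, hXA, hXd, hX⟩ := hA.exists_core
  have : TopologicalSpace.SeparableSpace X :=
    (TopologicalSpace.IsSeparable.of_separableSpace (X : Set H)).separableSpace
  let x : ℕ → X := TopologicalSpace.denseSeq X
  let Y := {W : Submodule ℂ H // W ≤ X ∧ FiniteDimensional ℂ W}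
  have hstep : ∀ (n : ℕ) (W₀ : Y), ∃ W : Y, W₀.1 ≤ W.1 ∧ (x n : H) ∈ W.1 ∧
      ∀ w : A.domain, (w : H) ∈ W.1 → ∃ v ∈ W.1, ‖A w - v‖ ≤ (1 / 2) ^ n * ‖(w : H)‖ := by
    rintro n ⟨W₀, h1, h2⟩
    obtain ⟨W, hW1, hW2, hW3, hW4⟩ := hX (W₀ ⊔ ℂ ∙ (x n : H))
      (sup_le h1 ((Submodule.span_singleton_le_iff_mem _ _).2 (x n).2)) inferInstance
      ((1 / 2) ^ n) (by positivity)
    exact ⟨⟨W, hW3, hW1⟩, le_sup_left.trans hW2,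
      hW2 (Submodule.mem_sup_right (Submodule.mem_span_singleton_self _)), hW4⟩
  choose next h1 h2 h3 using hstep
  let W : ℕ → Y := fun n => Nat.rec ⟨⊥, bot_le, inferInstance⟩ next n
  refine ⟨fun n => (W n).1, rfl, monotone_nat_of_le_succ fun n => h1 n (W n),
    fun n => (W n).2.2, fun n => (W n).2.1.trans hXA, ?_, fun n => h3 n (W n)⟩
  have hsub : (X : Set H) ⊆ closure ((⨆ n, (W n).1 : Submodule ℂ H) : Set H) := by
    intro y hy
    have hy' : (⟨y, hy⟩ : X) ∈ closure (Set.range x) := TopologicalSpace.denseRange_denseSeq X _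
    have := image_closure_subset_closure_image continuous_subtype_val ⟨_, hy', rfl⟩
    refine closure_mono ?_ this
    rintro _ ⟨_, ⟨n, rfl⟩, rfl⟩
    exact Submodule.mem_iSup_of_mem (n + 1) (h2 n (W n))
  exact fun y => closure_minimal hsub isClosed_closure (hXd y)

end Chain

section Diagonalization

variable {H : Type*} [NormedAddCommGroup H] [InnerProductSpace ℂ H] [CompleteSpace H]
  [TopologicalSpace.SeparableSpace H]

/-- A self-adjoint operator is block diagonal up to a compact perturbation. -/
theorem IsSelfAdjointOp.exists_blocks {A : H →ₗ.[ℂ] H} (hA : IsSelfAdjointOp A) :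
    ∃ (W : ℕ → Submodule ℂ H) (K : H →L[ℂ] H), W 0 = ⊥ ∧ Monotone W ∧
      (∀ n, FiniteDimensional ℂ (W n)) ∧ (∀ n, W n ≤ A.domain) ∧
      Dense ((⨆ n, W n : Submodule ℂ H) : Set H) ∧ IsCompactOperator K ∧ IsSelfAdjoint K ∧
      ∀ n, ∀ v : A.domain, (v : H) ∈ W (n + 1) ⊓ (W n)ᗮ →
        A v - K v ∈ W (n + 1) ⊓ (W n)ᗮ := by
  obtain ⟨W, hW0, hmono, hfin, hWA, hdense, happ⟩ := hA.exists_chain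
  let P : ℕ → H →L[ℂ] H := fun n => (W n).starProjection
  have hPmem : ∀ n x, P n x ∈ W n := fun n x => (W n).starProjection_apply_mem x
  have hPid : ∀ n x, x ∈ W n → P n x = x := fun n x hx =>
    Submodule.starProjection_eq_self_iff.2 hx
  have hPzero : ∀ n x, x ∈ (W n)ᗮ → P n x = 0 := fun n x hx =>
    (Submodule.starProjection_apply_eq_zero_iff _).2 hx
  have hPP : ∀ n m x, n ≤ m → P n (P m x) = P n x := fun n m x hnm =>
    congrArg (fun T : H →L[ℂ] H => T x)
      (Submodule.starProjection_comp_starProjection_of_le (hmono hnm))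
  have hPinner : ∀ n x y, inner ℂ (P n x) y = inner ℂ x (P n y) := fun n x y =>
    (W n).inner_starProjection_left_eq_right x y
  have hPadj : ∀ n, (P n).adjoint = P n := fun n => isSelfAdjoint_starProjection (W n)
  let T : ∀ n, W n →L[ℂ] H := fun n =>
    LinearMap.toContinuousLinearMap (A.toFun ∘ₗ Submodule.inclusion (hWA n))
  let C : ℕ → H →L[ℂ] H := fun n => T n ∘L (W n).orthogonalProjectionOnto
  have hC : ∀ n x, C n x = A ⟨P n x, hWA n (hPmem n x)⟩ := fun n x => rfl
  let L : ℕ → H →L[ℂ] H := fun n => (1 - P (n + 1)) ∘L C (n + 1) ∘L (1 - P n)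
  have hL : ∀ n x, L n x = C (n + 1) (x - P n x) - P (n + 1) (C (n + 1) (x - P n x)) :=
    fun n x => rfl
  have hLcpt : ∀ n, IsCompactOperator (L n) := by
    intro n
    have h : IsCompactOperator (W (n + 1)).orthogonalProjectionOnto :=
      isCompactOperator_of_locallyCompactSpace_dom _
    exact ((h.clm_comp (T (n + 1))).comp_clm (1 - P n)).clm_comp (1 - P (n + 1))
  have hLadj : ∀ n, (L n).adjoint = (1 - P n) ∘L (C (n + 1)).adjoint ∘L (1 - P (n + 1)) := by
    intro n
    simp only [L, ContinuousLinearMap.adjoint_comp, _root_.map_sub, hPadj,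
      ContinuousLinearMap.one_def, ContinuousLinearMap.adjoint_id]
    rfl
  have hLcpt' : ∀ n, IsCompactOperator (L n).adjoint := by
    intro n
    have h : IsCompactOperator (T (n + 1)).adjoint :=
      isCompactOperator_of_locallyCompactSpace_dom _
    rw [hLadj, ContinuousLinearMap.adjoint_comp]
    exact ((h.clm_comp ((W (n + 1)).orthogonalProjectionOnto.adjoint)).comp_clm
      (1 - P (n + 1))).clm_comp (1 - P n)
  have hCadj : ∀ n (v : A.domain), (C n).adjoint (v : H) = P n (A v) := by
    intro n v
    refine ext_inner_right ℂ fun y => ?_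
    rw [ContinuousLinearMap.adjoint_inner_left, hC, hPinner]
    exact (hA.inner_apply_left v ⟨P n y, hWA n (hPmem n y)⟩).symm
  have hLnorm : ∀ n, ‖L n‖ ≤ (1 / 2) ^ n := by
    intro n
    refine ContinuousLinearMap.opNorm_le_bound _ (by positivity) fun x => ?_
    obtain ⟨v, hv, hv'⟩ := happ n ⟨P (n + 1) (x - P n x), hWA _ (hPmem _ _)⟩ (hPmem _ _)
    rw [← hC] at hv'
    have h1 : ‖L n x‖ ≤ ‖C (n + 1) (x - P n x) - v‖ := by
      rw [hL]
      exact ((W (n + 1)).starProjection_minimal (C (n + 1) (x - P n x))).trans_le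
        (ciInf_le ⟨0, by rintro _ ⟨y, rfl⟩; exact norm_nonneg _⟩ (⟨v, hv⟩ : W (n + 1)))
    have h2 : ‖P (n + 1) (x - P n x)‖ ≤ ‖x - P n x‖ := (W (n + 1)).norm_starProjection_apply_le _
    have h3 : ‖x - P n x‖ ≤ ‖x‖ := by
      have := ((W n).starProjection_minimal x).trans_le
        (ciInf_le ⟨0, by rintro _ ⟨y, rfl⟩; exact norm_nonneg _⟩ (0 : W n))
      simpa using this
    calc ‖L n x‖ ≤ _ := h1.trans hv'
      _ ≤ _ := by
        simp only
        gcongr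
        exact h2.trans h3
  let F : ℕ → H →L[ℂ] H := fun n => L n + (L n).adjoint
  have hFsum : Summable F := by
    refine Summable.of_norm_bounded (g := fun n => 2 * (1 / 2 : ℝ) ^ n)
      (summable_geometric_two.mul_left 2) fun n => ?_
    have : ‖(L n).adjoint‖ = ‖L n‖ := LinearIsometryEquiv.norm_map _ _
    calc ‖F n‖ ≤ ‖L n‖ + ‖(L n).adjoint‖ := norm_add_le _ _
      _ ≤ _ := by rw [this]; linarith [hLnorm n]
  have hKcpt : IsCompactOperator ((∑' n, F n : H →L[ℂ] H) : H → H) := by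
    refine isCompactOperator_of_tendsto (l := atTop) hFsum.hasSum.tendsto_sum_nat
      (Eventually.of_forall fun n => ?_)
    induction n with
    | zero => simpa using isCompactOperator_zero
    | succ n ih =>
      rw [Finset.sum_range_succ]
      exact ih.add ((hLcpt n).add (hLcpt' n))
  have hKsa : IsSelfAdjoint (∑' n, F n) := by
    have : ∀ n, star (F n) = F n := by
      intro n
      simp only [F, star_add, ← ContinuousLinearMap.star_eq_adjoint, star_star, add_comm]
    rw [IsSelfAdjoint, tsum_star]
    simp only [this]
  refine ⟨W, ∑' n, F n, hW0, hmono, hfin, hWA, hdense, hKcpt, hKsa, ?_⟩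
  rintro n v ⟨hv1, hv2⟩
  have hvP : ∀ m, n + 1 ≤ m → P m v = v := fun m hm => hPid m v (hmono hm hv1)
  have hvP0 : ∀ m, m ≤ n → P m v = 0 := fun m hm =>
    hPzero m v (Submodule.orthogonal_le (hmono hm) hv2)
  have hF1 : ∀ m, m < n → F m v = P (m + 1) (A v) - P m (A v) := by
    intro m hm
    have h1 : L m v = 0 := by
      rw [hL, hvP0 m hm.le, sub_zero]
      have : C (m + 1) v = 0 := by
        rw [hC]
        have : (⟨P (m + 1) v, hWA _ (hPmem _ _)⟩ : A.domain) = 0 := Subtype.ext (hvP0 (m + 1) hm)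
        rw [this, LinearPMap.map_zero]
      rw [this, _root_.map_zero, sub_zero]
    have h2 : (L m).adjoint v = P (m + 1) (A v) - P m (A v) := by
      rw [hLadj]
      change (C (m + 1)).adjoint ((v : H) - P (m + 1) v) -
        P m ((C (m + 1)).adjoint ((v : H) - P (m + 1) v)) = _
      rw [hvP0 (m + 1) hm, sub_zero, hCadj, hPP _ _ _ m.le_succ]
    change L m v + (L m).adjoint v = _
    rw [h1, h2, zero_add]
  have hFadj : ∀ m, n ≤ m → (L m).adjoint v = 0 := by
    intro m hm
    rw [hLadj]
    change (C (m + 1)).adjoint ((v : H) - P (m + 1) v) -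
      P m ((C (m + 1)).adjoint ((v : H) - P (m + 1) v)) = _
    rw [hvP (m + 1) (by lia), sub_self, _root_.map_zero, _root_.map_zero, sub_zero]
  have hF2 : F n v = A v - P (n + 1) (A v) := by
    change L n v + (L n).adjoint v = _
    have : C (n + 1) v = A v := by
      rw [hC]
      congr 1
      exact Subtype.ext (hvP (n + 1) le_rfl)
    rw [hFadj n le_rfl, hL, hvP0 n le_rfl, sub_zero, add_zero, this]
  have hF3 : ∀ m, n < m → F m v = 0 := by
    intro m hm
    change L m v + (L m).adjoint v = _
    rw [hFadj m hm.le, hL, hvP m hm, sub_self, _root_.map_zero, _root_.map_zero, sub_zero,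
      add_zero]
  have hK : (∑' m, F m) v = A v - P (n + 1) (A v) + P n (A v) := by
    have h1 : HasSum (fun m => F m v) ((∑' m, F m) v) :=
      hFsum.hasSum.mapL (ContinuousLinearMap.apply ℂ H (v : H))
    have h2 : HasSum (fun m => F m v) (∑ m ∈ Finset.range (n + 1), F m v) :=
      hasSum_sum_of_ne_finset_zero fun m hm => hF3 m (by simpa using hm)
    rw [h1.unique h2, Finset.sum_range_succ, hF2,
      Finset.sum_congr rfl fun m hm => hF1 m (Finset.mem_range.1 hm),
      Finset.sum_range_sub (fun m => P m (A v)), hPzero 0 (A v) (by simp [hW0]), sub_zero,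
      add_comm]
  have hfinal : A v - (∑' m, F m) v = P (n + 1) (A v) - P n (A v) := by
    rw [hK]; abel
  rw [hfinal]
  refine ⟨sub_mem (hPmem _ _) (hmono n.le_succ (hPmem _ _)), ?_⟩
  refine (Submodule.starProjection_apply_eq_zero_iff _).1 ?_
  change P n (P (n + 1) (A v) - P n (A v)) = 0
  rw [_root_.map_sub, hPP _ _ _ n.le_succ, hPP _ _ _ le_rfl, sub_self]

/-- **Weyl–von Neumann theorem**: a self-adjoint operator is diagonal up to a compact
perturbation. -/
theorem IsSelfAdjointOp.exists_diagonalization {A : H →ₗ.[ℂ] H} (hA : IsSelfAdjointOp A)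
    (hdim : ¬ FiniteDimensional ℂ H) :
    ∃ (b : HilbertBasis ℕ ℂ H) (d : ℕ → ℝ) (K : H →L[ℂ] H), IsCompactOperator K ∧
      IsSelfAdjoint K ∧
      ∀ n, ∃ h : b n ∈ A.domain, A ⟨b n, h⟩ - K (b n) = (d n : ℂ) • b n := by
  obtain ⟨W, K, hW0, hmono, hfin, hWA, hdense, hKc, hKs, hblock⟩ := hA.exists_blocks
  let U : ℕ → Submodule ℂ H := fun n => W (n + 1) ⊓ (W n)ᗮ
  have hUfin : ∀ n, FiniteDimensional ℂ (U n) := fun n =>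
    Submodule.finiteDimensional_of_le (inf_le_left : U n ≤ W (n + 1))
  have hUA : ∀ n, U n ≤ A.domain := fun n => inf_le_left.trans (hWA (n + 1))
  let S : ∀ n, U n →ₗ[ℂ] U n := fun n =>
    ((A.toFun ∘ₗ Submodule.inclusion (hUA n)) - (K : H →ₗ[ℂ] H) ∘ₗ (U n).subtype).codRestrict
      (U n) fun v => hblock n ⟨v, hUA n v.2⟩ v.2
  have hS : ∀ n v, ((S n v : U n) : H) = A ⟨v, hUA n v.2⟩ - K v := fun n v => rfl
  have hSsymm : ∀ n, (S n).IsSymmetric := by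
    intro n v w
    rw [Submodule.coe_inner, Submodule.coe_inner, hS, hS, inner_sub_left, inner_sub_right]
    have h1 := hA.inner_apply_left ⟨v, hUA n v.2⟩ ⟨w, hUA n w.2⟩
    have h2 : inner ℂ (K v) (w : H) = inner ℂ (v : H) (K w) := hKs.isSymmetric v w
    rw [h2]
    exact congrArg (· - _) h1
  let e : ∀ n, OrthonormalBasis (Fin (Module.finrank ℂ (U n))) ℂ (U n) := fun n =>
    (hSsymm n).eigenvectorBasis rfl
  have horth : OrthogonalFamily ℂ (fun n => U n) fun n => (U n).subtypeₗᵢ := by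
    have hlt : ∀ i j, i < j → U i ⟂ U j := fun i j hij =>
      (Submodule.isOrtho_orthogonal_right (W j)).mono (inf_le_left.trans (hmono hij)) inf_le_right
    refine orthogonalFamily_iff_pairwise.2 fun i j hij => ?_
    rcases hij.lt_or_gt with h | h
    · exact hlt i j h
    · exact (hlt j i h).symm
  let I := Σ n, Fin (Module.finrank ℂ (U n))
  let v : I → H := fun a => (U a.1).subtypeₗᵢ (e a.1 a.2)
  have hv : Orthonormal ℂ v :=
    horth.orthonormal_sigma_orthonormal (v_family := fun n => e n) fun n => (e n).orthonormal
  have hUspan : ∀ n, U n ≤ Submodule.span ℂ (Set.range v) := by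
    intro n x hx
    have h1 := (e n).sum_repr ⟨x, hx⟩
    have h2 := congrArg (U n).subtype h1
    rw [_root_.map_sum] at h2
    change _ = x at h2
    rw [← h2]
    refine Submodule.sum_mem _ fun i _ => ?_
    rw [_root_.map_smul]
    exact Submodule.smul_mem _ _ (Submodule.subset_span ⟨⟨n, i⟩, rfl⟩)
  have hWspan : ∀ n, W n ≤ Submodule.span ℂ (Set.range v) := by
    intro n
    induction n with
    | zero => rw [hW0]; exact bot_le
    | succ n ih =>
      intro x hx
      have h1 : (W n).starProjection x ∈ W n := (W n).starProjection_apply_mem x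
      have h2 : x - (W n).starProjection x ∈ U n :=
        ⟨sub_mem hx (hmono n.le_succ h1), (W n).sub_starProjection_mem_orthogonal x⟩
      simpa using add_mem (hUspan n h2) (ih h1)
  have hvdense : Dense (Submodule.span ℂ (Set.range v) : Set H) :=
    hdense.mono (iSup_le hWspan : (⨆ n, W n) ≤ _)
  have hinf : Infinite I := by
    by_contra hI
    rw [not_infinite_iff_finite] at hI
    have hfd : FiniteDimensional ℂ (Submodule.span ℂ (Set.range v)) :=
      FiniteDimensional.span_of_finite ℂ (Set.finite_range v)
    have htop : Submodule.span ℂ (Set.range v) = ⊤ := by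
      rw [← SetLike.coe_set_eq, ← (Submodule.closed_of_finiteDimensional _).closure_eq,
        hvdense.closure_eq]
      rfl
    rw [htop] at hfd
    exact hdim (Module.finite_def.2 (Module.Finite.iff_fg.1 hfd))
  obtain ⟨_⟩ := nonempty_denumerable I
  let f : ℕ ≃ I := (Denumerable.eqv I).symm
  let b : HilbertBasis ℕ ℂ H := HilbertBasis.mk (hv.comp f f.injective) (by
    rw [f.surjective.range_comp]
    exact fun x _ => hvdense x)
  have hb : ∀ n, b n = v (f n) := fun n => congrFun (HilbertBasis.coe_mk _ _) n
  refine ⟨b, fun n => (hSsymm (f n).1).eigenvalues rfl (f n).2, K, hKc, hKs, fun n => ?_⟩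
  have hmem : b n ∈ U (f n).1 := by rw [hb]; exact Subtype.coe_prop _
  refine ⟨hUA _ hmem, ?_⟩
  have h1 := congrArg (U (f n).1).subtype
    ((hSsymm (f n).1).apply_eigenvectorBasis rfl (f n).2)
  simp only [hb]
  exact h1

end Diagonalization

section Diagonal

variable {H : Type*} [NormedAddCommGroup H] [InnerProductSpace ℂ H]

theorem HilbertBasis.hasSum_norm_inner_sq (b : HilbertBasis ℕ ℂ H) (x : H) :
    HasSum (fun n => ‖inner ℂ (b n) x‖ ^ 2) (‖x‖ ^ 2) := by
  have h := b.hasSum_inner_mul_inner x x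
  rw [inner_self_eq_norm_sq_to_K] at h
  have h2 : ∀ n, inner ℂ x (b n) * inner ℂ (b n) x = ((‖inner ℂ (b n) x‖ ^ 2 : ℝ) : ℂ) := by
    intro n
    rw [← inner_conj_symm x (b n), RCLike.conj_mul]
    norm_cast
  simp only [h2] at h
  have h3 := Complex.reCLM.hasSum h
  norm_cast at h3

theorem HilbertBasis.ext_inner (b : HilbertBasis ℕ ℂ H) {x y : H}
    (h : ∀ n, inner ℂ (b n) x = inner ℂ (b n) y) : x = y := by
  apply b.repr.injective
  ext n
  rw [b.repr_apply_apply, b.repr_apply_apply, h]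

theorem HilbertBasis.inner_repr_symm (b : HilbertBasis ℕ ℂ H) {f : ℕ → ℂ} (hf : Memℓp f 2)
    (n : ℕ) : inner ℂ (b n) (b.repr.symm (⟨f, hf⟩ : lp (fun _ => ℂ) 2)) = f n := by
  rw [← b.repr_apply_apply, LinearIsometryEquiv.apply_symm_apply]

/-- The maximal diagonal operator with eigenvalues `d` in the basis `b`. -/
noncomputable def diagonalOp (b : HilbertBasis ℕ ℂ H) (d : ℕ → ℝ) : H →ₗ.[ℂ] H where
  domain :=
    { carrier := {x | Memℓp (fun n => (d n : ℂ) * inner ℂ (b n) x) 2}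
      add_mem' := fun {x y} hx hy => by
        refine (congrArg (Memℓp · 2) ?_).mpr (Memℓp.add hx hy)
        funext n
        simp [mul_add]
      zero_mem' := by
        refine (congrArg (Memℓp · 2) ?_).mpr (zero_memℓp (E := fun _ : ℕ => ℂ))
        funext n
        simp
      smul_mem' := fun c x hx => by
        refine (congrArg (Memℓp · 2) ?_).mpr (Memℓp.const_smul hx c)
        funext n
        simp [mul_left_comm] }
  toFun :=
    { toFun := fun x => b.repr.symm ⟨_, x.2⟩
      map_add' := fun x y => b.ext_inner fun n => by
        simp_rw [inner_add_right, b.inner_repr_symm]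
        simp [mul_add]
      map_smul' := fun c x => b.ext_inner fun n => by
        simp_rw [inner_smul_right, b.inner_repr_symm]
        simp [mul_left_comm] }

theorem mem_diagonalOp_domain {b : HilbertBasis ℕ ℂ H} {d : ℕ → ℝ} {x : H} :
    x ∈ (diagonalOp b d).domain ↔ Memℓp (fun n => (d n : ℂ) * inner ℂ (b n) x) 2 := Iff.rfl

theorem inner_diagonalOp (b : HilbertBasis ℕ ℂ H) (d : ℕ → ℝ) (x : (diagonalOp b d).domain)
    (n : ℕ) : inner ℂ (b n) (diagonalOp b d x) = d n * inner ℂ (b n) (x : H) :=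
  b.inner_repr_symm x.2 n

theorem basis_mem_diagonalOp_domain (b : HilbertBasis ℕ ℂ H) (d : ℕ → ℝ) (n : ℕ) :
    b n ∈ (diagonalOp b d).domain := by
  rw [mem_diagonalOp_domain]
  refine memℓp_gen (summable_of_ne_finset_zero (s := {n}) fun m hm => ?_)
  have : inner ℂ (b m) (b n) = 0 := b.orthonormal.2 (by simpa using hm)
  simp [this]

theorem diagonalOp_basis (b : HilbertBasis ℕ ℂ H) (d : ℕ → ℝ) (n : ℕ) :
    diagonalOp b d ⟨b n, basis_mem_diagonalOp_domain b d n⟩ = (d n : ℂ) • b n := by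
  refine b.ext_inner fun m => ?_
  rw [inner_diagonalOp, inner_smul_right]
  by_cases hmn : m = n
  · rw [hmn]
  · have : inner ℂ (b m) (b n) = 0 := b.orthonormal.2 hmn
    simp [this]

/-- `A - K` is diagonal with eigenvalues `d` in the basis `b`. -/
def IsDiagonalModulo (A : H →ₗ.[ℂ] H) (b : HilbertBasis ℕ ℂ H) (d : ℕ → ℝ)
    (K : H →L[ℂ] H) : Prop :=
  ∀ n, ∃ h : b n ∈ A.domain, A ⟨b n, h⟩ - K (b n) = (d n : ℂ) • b n

theorem isDiagonalModulo_diagonalOp (b : HilbertBasis ℕ ℂ H) (d : ℕ → ℝ) :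
    IsDiagonalModulo (diagonalOp b d) b d 0 := fun n =>
  ⟨basis_mem_diagonalOp_domain b d n, by
    rw [_root_.zero_apply, sub_zero, diagonalOp_basis]⟩

theorem Orthonormal.tendsto_inner_zero {x : ℕ → H} (hx : Orthonormal ℂ x) (y : H) :
    Tendsto (fun n => inner ℂ (x n) y) atTop (𝓝 0) := by
  have h := (hx.inner_products_summable y).tendsto_atTop_zero
  rw [tendsto_zero_iff_norm_tendsto_zero]
  have := h.sqrt
  simpa [Real.sqrt_sq (norm_nonneg _)] using this

variable [CompleteSpace H]

theorem IsCompactOperator.tendsto_zero_of_orthonormal {K : H →L[ℂ] H}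
    (hK : IsCompactOperator K) {x : ℕ → H} (hx : Orthonormal ℂ x) :
    Tendsto (fun n => K (x n)) atTop (𝓝 0) := by
  refine tendsto_of_subseq_tendsto fun ns hns => ?_
  have hcpt := hK.isCompact_closure_image_closedBall (1 : ℝ)
  have hmem : ∀ n, K (x (ns n)) ∈ closure (K '' closedBall 0 1) := fun n =>
    subset_closure ⟨_, by simp [hx.1], rfl⟩
  obtain ⟨z, -, φ, hφ, hz⟩ := hcpt.tendsto_subseq hmem
  have h1 : Tendsto (fun n => inner ℂ (K (x (ns (φ n)))) z) atTop (𝓝 (inner ℂ z z)) :=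
    hz.inner tendsto_const_nhds
  have h2 : Tendsto (fun n => inner ℂ (K (x (ns (φ n)))) z) atTop (𝓝 0) := by
    have := (hx.tendsto_inner_zero (K.adjoint z)).comp (hns.comp hφ.tendsto_atTop)
    simpa [Function.comp_def, ContinuousLinearMap.adjoint_inner_right] using this
  have hz0 : z = 0 := inner_self_eq_zero.1 (tendsto_nhds_unique h1 h2)
  exact ⟨φ, hz0 ▸ hz⟩

namespace IsDiagonalModulo

variable {A : H →ₗ.[ℂ] H} {b : HilbertBasis ℕ ℂ H} {d : ℕ → ℝ} {K : H →L[ℂ] H}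

theorem inner_apply (h : IsDiagonalModulo A b d K) (hA : IsSelfAdjointOp A)
    (hK : IsSelfAdjoint K) (x : A.domain) (n : ℕ) :
    inner ℂ (b n) (A x - K x) = d n * inner ℂ (b n) (x : H) := by
  obtain ⟨h1, h2⟩ := h n
  have h3 : inner ℂ (K (b n)) (x : H) = inner ℂ (b n) (K x) := hK.isSymmetric _ _
  rw [inner_sub_right, ← h3, ← hA.inner_apply_left ⟨b n, h1⟩ x, ← inner_sub_left, h2,
    inner_smul_left, Complex.conj_ofReal]

theorem mem_domain_iff (h : IsDiagonalModulo A b d K) (hA : IsSelfAdjointOp A)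
    (hK : IsSelfAdjoint K) (x : H) :
    x ∈ A.domain ↔ Memℓp (fun n => (d n : ℂ) * inner ℂ (b n) x) 2 := by
  constructor
  · intro hx
    have : (fun n => (d n : ℂ) * inner ℂ (b n) x) = b.repr (A ⟨x, hx⟩ - K x) := by
      funext n
      rw [b.repr_apply_apply, h.inner_apply hA hK ⟨x, hx⟩]
    rw [this]
    exact lp.memℓp _
  · intro hx
    let w : H := b.repr.symm ⟨_, hx⟩
    have hw : ∀ n, inner ℂ (b n) w = d n * inner ℂ (b n) x := by
      intro n
      rw [← b.repr_apply_apply, LinearIsometryEquiv.apply_symm_apply]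
    refine (hA.exists_apply_eq (w := w + K x) fun y => ?_).1
    have h1 : inner ℂ w (y : H) = inner ℂ x (A y - K y) := by
      rw [← b.tsum_inner_mul_inner, ← b.tsum_inner_mul_inner]
      congr 1
      funext n
      rw [h.inner_apply hA hK y, ← inner_conj_symm w, hw, map_mul, inner_conj_symm,
        Complex.conj_ofReal]
      ring
    have h2 : inner ℂ (K x) (y : H) = inner ℂ x (K y) := hK.isSymmetric _ _
    rw [inner_add_left, h1, h2, inner_sub_right, sub_add_cancel]

theorem essSpec_eq (h : IsDiagonalModulo A b d K) (hA : IsSelfAdjointOp A)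
    (hK : IsSelfAdjoint K) (hKc : IsCompactOperator K) :
    essSpec A = {t | ∀ ε > 0, {n | |d n - t| < ε}.Infinite} := by
  ext t
  constructor
  · rintro ⟨x, hx, hlim⟩ ε hε hF
    rw [← tendsto_zero_iff_norm_tendsto_zero] at hlim
    have h1 : Tendsto (fun k => ‖A (x k) - K (x k) - (t : ℂ) • (x k : H)‖ ^ 2 +
        ε ^ 2 * ∑ n ∈ hF.toFinset, ‖inner ℂ (b n) (x k : H)‖ ^ 2) atTop (𝓝 0) := by
      have h2 := hlim.sub (hKc.tendsto_zero_of_orthonormal hx)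
      have h3 : Tendsto (fun k => ∑ n ∈ hF.toFinset, ‖inner ℂ (b n) (x k : H)‖ ^ 2) atTop
          (𝓝 (∑ n ∈ hF.toFinset, 0)) := by
        refine tendsto_finsetSum _ fun n _ => ?_
        have := (hx.tendsto_inner_zero (b n)).norm.pow 2
        simpa [norm_inner_symm] using this
      have h4 := (h2.norm.pow 2).add (h3.const_mul (ε ^ 2))
      simpa [sub_right_comm] using h4
    have h2 : ∀ k, ε ^ 2 ≤ ‖A (x k) - K (x k) - (t : ℂ) • (x k : H)‖ ^ 2 +
        ε ^ 2 * ∑ n ∈ hF.toFinset, ‖inner ℂ (b n) (x k : H)‖ ^ 2 := by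
      intro k
      have h3 := (b.hasSum_norm_inner_sq (x k : H)).mul_left (ε ^ 2)
      have hnorm : ‖(x k : H)‖ = 1 := hx.1 k
      rw [hnorm] at h3
      have h4 := b.hasSum_norm_inner_sq (A (x k) - K (x k) - (t : ℂ) • (x k : H))
      have h5 : HasSum (fun n => if n ∈ hF.toFinset then ‖inner ℂ (b n) (x k : H)‖ ^ 2 else 0)
          (∑ n ∈ hF.toFinset, ‖inner ℂ (b n) (x k : H)‖ ^ 2) := by
        rw [← Finset.sum_congr rfl fun n hn => if_pos hn]
        exact hasSum_sum_of_ne_finset_zero fun n hn => if_neg hn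
      have h6 := hasSum_le (fun n => ?_) h3 (h4.add (h5.mul_left (ε ^ 2)))
      · simpa using h6
      have h7 : inner ℂ (b n) (A (x k) - K (x k) - (t : ℂ) • (x k : H)) =
          ((d n - t : ℝ) : ℂ) * inner ℂ (b n) (x k : H) := by
        rw [inner_sub_right, h.inner_apply hA hK, inner_smul_right]
        push_cast
        ring
      rw [h7, norm_mul, mul_pow, Complex.norm_real, Real.norm_eq_abs]
      by_cases hn : n ∈ hF.toFinset
      · rw [if_pos hn]
        nlinarith [mul_nonneg (sq_nonneg |d n - t|) (sq_nonneg ‖inner ℂ (b n) (x k : H)‖)]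
      · rw [if_neg hn, mul_zero, add_zero]
        have : ε ≤ |d n - t| := by simpa using hn
        gcongr
    have := ge_of_tendsto' h1 h2
    nlinarith [pow_pos hε 2]
  · intro ht
    obtain ⟨φ, hφ, hd⟩ := extraction_forall_of_frequently
      (P := fun k n => |d n - t| < 1 / ((k : ℝ) + 1)) fun k =>
        Nat.frequently_atTop_iff_infinite.2 (ht _ (by positivity))
    have hort : Orthonormal ℂ fun k => b (φ k) := b.orthonormal.comp φ hφ.injective
    refine ⟨fun k => ⟨b (φ k), (h (φ k)).1⟩, hort, ?_⟩
    have h1 : ∀ k, A ⟨b (φ k), (h (φ k)).1⟩ - (t : ℂ) • b (φ k) =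
        ((d (φ k) - t : ℝ) : ℂ) • b (φ k) + K (b (φ k)) := by
      intro k
      rw [sub_eq_iff_eq_add.1 (h (φ k)).2]
      push_cast
      rw [sub_smul]
      abel
    simp only [h1]
    rw [← tendsto_zero_iff_norm_tendsto_zero]
    rw [← add_zero (0 : H)]
    refine Tendsto.add ?_ (hKc.tendsto_zero_of_orthonormal hort)
    refine squeeze_zero_norm (fun k => ?_) tendsto_one_div_add_atTop_nhds_zero_nat
    rw [norm_smul, hort.1 k, mul_one, Complex.norm_real, Real.norm_eq_abs]
    exact (hd k).le

end IsDiagonalModulo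

theorem isSelfAdjointOp_diagonalOp (b : HilbertBasis ℕ ℂ H) (d : ℕ → ℝ) :
    IsSelfAdjointOp (diagonalOp b d) := by
  have hdense : Dense ((diagonalOp b d).domain : Set H) := by
    have h1 : Dense (Submodule.span ℂ (Set.range b) : Set H) :=
      (Submodule.dense_iff_topologicalClosure_eq_top).2 b.dense_span
    refine h1.mono (Submodule.span_le.2 ?_)
    rintro _ ⟨n, rfl⟩
    exact basis_mem_diagonalOp_domain b d n
  have hadj : ∀ (y : (diagonalOp b d).adjoint.domain) (n : ℕ),
      inner ℂ (b n) ((diagonalOp b d).adjoint y) = d n * inner ℂ (b n) (y : H) := by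
    intro y n
    have h := (diagonalOp b d).adjoint_isFormalAdjoint hdense y
      ⟨b n, basis_mem_diagonalOp_domain b d n⟩
    rw [diagonalOp_basis, inner_smul_right] at h
    rw [← inner_conj_symm, h, map_mul, inner_conj_symm, Complex.conj_ofReal]
  have hmem : ∀ y : (diagonalOp b d).adjoint.domain, (y : H) ∈ (diagonalOp b d).domain := by
    intro y
    have h : (fun n => (d n : ℂ) * inner ℂ (b n) (y : H)) =
        b.repr ((diagonalOp b d).adjoint y) := by
      funext n
      rw [b.repr_apply_apply, hadj]
    rw [mem_diagonalOp_domain, h]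
    exact lp.memℓp _
  refine ⟨hdense, le_antisymm (And.intro (fun y hy => hmem ⟨y, hy⟩) fun y z hyz => ?_)
    (LinearPMap.IsFormalAdjoint.le_adjoint hdense fun x y => ?_)⟩
  · exact b.ext_inner fun n => by rw [hadj, inner_diagonalOp, hyz]
  · rw [← b.tsum_inner_mul_inner, ← b.tsum_inner_mul_inner]
    congr 1
    funext n
    rw [inner_diagonalOp, ← inner_conj_symm _ (b n), inner_diagonalOp, map_mul, inner_conj_symm,
      Complex.conj_ofReal]
    ring

end Diagonal

section Matching

theorem tendsto_infDist_of_noLargeHoles_s0 {M : Set ℝ} {d : ℕ → ℝ} (hM : NoLargeHoles M)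
    (hd : {t | ∀ ε > 0, {n | |d n - t| < ε}.Infinite} ⊆ M) :
    Tendsto (fun n => infDist (d n) M) atTop (𝓝 0) := by
  rw [Metric.tendsto_atTop]
  by_contra! hcon
  obtain ⟨ε, hε, hfreq⟩ := hcon
  obtain ⟨N, hN, hlarge⟩ := hM.2 ε hε
  obtain ⟨φ, hφ, hfar⟩ := extraction_of_frequently_atTop (frequently_atTop.2 hfreq)
  have hfar' : ∀ n, ε ≤ infDist (d (φ n)) M := fun n => by
    simpa [Real.dist_eq, abs_of_nonneg infDist_nonneg] using hfar n
  have hbdd : ∀ n, d (φ n) ∈ Set.Icc (-N) N := by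
    intro n
    refine abs_le.1 ?_
    by_contra! h
    have hnot : d (φ n) ∉ M := fun hmem => by
      have := hfar' n
      rw [infDist_zero_of_mem hmem] at this
      linarith
    linarith [hlarge _ hnot h, hfar' n]
  obtain ⟨t, -, ψ, hψ, ht⟩ := isCompact_Icc.tendsto_subseq hbdd
  have htM : t ∈ M := by
    refine hd fun δ hδ => ?_
    rw [← Nat.frequently_atTop_iff_infinite]
    have hev : ∀ᶠ k in atTop, |d (φ (ψ k)) - t| < δ := ht.eventually (Metric.ball_mem_nhds t hδ)
    exact (hφ.tendsto_atTop.comp hψ.tendsto_atTop).frequently hev.frequently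
  have hlim := ((continuous_infDist_pt M).tendsto t).comp ht
  rw [infDist_zero_of_mem htM] at hlim
  linarith [ge_of_tendsto' hlim fun n => hfar' (ψ n)]

theorem exists_strictMono_near {M : Set ℝ} {d d' : ℕ → ℝ} (hM : M.Nonempty)
    (hd' : M ⊆ {t | ∀ ε > 0, {n | |d' n - t| < ε}.Infinite}) :
    ∃ φ : ℕ → ℕ, StrictMono φ ∧ ∀ n, |d n - d' (φ n)| < infDist (d n) M + 1 / (n + 1) := by
  refine extraction_forall_of_frequently
    (P := fun n k => |d n - d' k| < infDist (d n) M + 1 / (n + 1)) fun n => ?_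
  rw [Nat.frequently_atTop_iff_infinite]
  obtain ⟨t, ht, hlt⟩ := (infDist_lt_iff hM).1
    (show infDist (d n) M < infDist (d n) M + 1 / (n + 1) by
      have : (0 : ℝ) < 1 / (n + 1) := by positivity
      linarith)
  refine (hd' ht _ (sub_pos.2 hlt)).mono fun k hk => ?_
  rw [Set.mem_ofPred_eq] at hk ⊢
  rw [Real.dist_eq] at hk
  have := abs_sub_le (d n) t (d' k)
  rw [abs_sub_comm t] at this
  linarith

theorem exists_equiv_tendsto_sub {M : Set ℝ} {d d' : ℕ → ℝ} (hM : NoLargeHoles M)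
    (hd : {t | ∀ ε > 0, {n | |d n - t| < ε}.Infinite} = M)
    (hd' : {t | ∀ ε > 0, {n | |d' n - t| < ε}.Infinite} = M) :
    ∃ σ : ℕ ≃ ℕ, Tendsto (fun n => d' (σ n) - d n) atTop (𝓝 0) := by
  obtain ⟨f, hf, hf'⟩ := exists_strictMono_near (d := d) hM.1 hd'.ge
  obtain ⟨g, hg, hg'⟩ := exists_strictMono_near (d := d') hM.1 hd.ge
  let e : ℕ → ℝ := fun n => infDist (d n) M + 1 / (n + 1)
  let e' : ℕ → ℝ := fun n => infDist (d' n) M + 1 / (n + 1)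
  have he0 : ∀ n, 0 ≤ e n := fun n => add_nonneg infDist_nonneg (by positivity)
  have he0' : ∀ n, 0 ≤ e' n := fun n => add_nonneg infDist_nonneg (by positivity)
  have he : Tendsto e atTop (𝓝 0) := by
    rw [← add_zero (0 : ℝ)]
    exact (tendsto_infDist_of_noLargeHoles_s0 hM hd.le).add
      tendsto_one_div_add_atTop_nhds_zero_nat
  have he' : Tendsto e' atTop (𝓝 0) := by
    rw [← add_zero (0 : ℝ)]
    exact (tendsto_infDist_of_noLargeHoles_s0 hM hd'.le).add
      tendsto_one_div_add_atTop_nhds_zero_nat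
  obtain ⟨h, hbij, hR⟩ := Function.Embedding.schroeder_bernstein_of_rel hf.injective hg.injective
    (fun n k => |d' k - d n| ≤ e n + e' k)
    (fun n => by rw [abs_sub_comm]; linarith [hf' n, he0' (f n)])
    (fun k => by linarith [hg' k, he0 (g k)])
  refine ⟨Equiv.ofBijective h hbij, ?_⟩
  have htop : Tendsto h atTop atTop := by
    simpa [Nat.cofinite_eq_atTop] using hbij.injective.tendsto_cofinite
  refine squeeze_zero_norm hR ?_
  simpa using he.add (he'.comp htop)

end Matching

section Equivalence

variable {H : Type*} [NormedAddCommGroup H] [InnerProductSpace ℂ H]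

theorem HilbertBasis.norm_le_of_diagonal (b : HilbertBasis ℕ ℂ H) {e : ℕ → ℝ} {C : ℝ}
    (hC : 0 ≤ C) (he : ∀ n, |e n| ≤ C) {x y : H}
    (h : ∀ n, inner ℂ (b n) y = e n * inner ℂ (b n) x) : ‖y‖ ≤ C * ‖x‖ := by
  have h1 := hasSum_le (fun n => ?_) (b.hasSum_norm_inner_sq y)
    ((b.hasSum_norm_inner_sq x).mul_left (C ^ 2))
  · rw [← mul_pow] at h1
    exact (sq_le_sq₀ (norm_nonneg _) (by positivity)).1 h1
  · rw [h, norm_mul, mul_pow, Complex.norm_real, Real.norm_eq_abs]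
    gcongr
    exact he n

theorem HilbertBasis.exists_bounded_diagonal (b : HilbertBasis ℕ ℂ H) {e : ℕ → ℝ} {C : ℝ}
    (hC : 0 ≤ C) (he : ∀ n, |e n| ≤ C) :
    ∃ E : H →L[ℂ] H, ∀ x n, inner ℂ (b n) (E x) = e n * inner ℂ (b n) x := by
  have hdom : ∀ x, x ∈ (diagonalOp b e).domain := by
    intro x
    rw [mem_diagonalOp_domain]
    refine memℓp_gen ?_
    simp only [ENNReal.toReal_ofNat, Real.rpow_two]
    refine Summable.of_nonneg_of_le (fun n => by positivity) (fun n => ?_)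
      ((b.hasSum_norm_inner_sq x).summable.mul_left (C ^ 2))
    rw [norm_mul, mul_pow, Complex.norm_real, Real.norm_eq_abs]
    gcongr
    exact he n
  let E : H →ₗ[ℂ] H := (diagonalOp b e).toFun ∘ₗ LinearMap.id.codRestrict _ hdom
  have hE : ∀ x n, inner ℂ (b n) (E x) = e n * inner ℂ (b n) x := fun x n =>
    inner_diagonalOp b e ⟨x, hdom x⟩ n
  exact ⟨E.mkContinuous C fun x => b.norm_le_of_diagonal hC he (hE x), hE⟩

variable [CompleteSpace H]

theorem HilbertBasis.exists_compact_diagonal (b : HilbertBasis ℕ ℂ H) {e : ℕ → ℝ}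
    (he : Tendsto e atTop (𝓝 0)) :
    ∃ E : H →L[ℂ] H, IsCompactOperator E ∧ IsSelfAdjoint E ∧
      ∀ x n, inner ℂ (b n) (E x) = e n * inner ℂ (b n) x := by
  obtain ⟨C, hC⟩ := he.norm.bddAbove_range
  have hC' : ∀ n, |e n| ≤ C := fun n => hC ⟨n, rfl⟩
  obtain ⟨E, hE⟩ := b.exists_bounded_diagonal ((abs_nonneg _).trans (hC' 0)) hC'
  refine ⟨E, ?_, ?_, hE⟩
  · let F : ℕ → H →L[ℂ] H := fun N => ∑ n ∈ Finset.range N,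
      (ContinuousLinearMap.toSpanSingleton ℂ ((e n : ℂ) • b n)) ∘L innerSL ℂ (b n)
    have hF : ∀ N x, F N x = ∑ n ∈ Finset.range N, inner ℂ (b n) x • (e n : ℂ) • b n := by
      intro N x
      simp [F]
    have hFc : ∀ N, IsCompactOperator (F N) := by
      intro N
      induction N with
      | zero => simpa [F] using isCompactOperator_zero
      | succ N ih =>
        simp only [F, Finset.sum_range_succ]
        have h1 : IsCompactOperator (innerSL ℂ (b N)) :=
          isCompactOperator_of_locallyCompactSpace_dom _
        exact ih.add (h1.clm_comp (ContinuousLinearMap.toSpanSingleton ℂ ((e N : ℂ) • b N)))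
    have hFb : ∀ N x m, inner ℂ (b m) (F N x) =
        if m < N then (e m : ℂ) * inner ℂ (b m) x else 0 := by
      intro N x m
      rw [hF, inner_sum]
      simp only [inner_smul_right, orthonormal_iff_ite.1 b.orthonormal]
      simp [mul_comm]
    refine isCompactOperator_of_tendsto (l := atTop) (F := F) ?_ (Eventually.of_forall hFc)
    rw [Metric.tendsto_atTop]
    intro ε hε
    obtain ⟨N, hN⟩ := Metric.tendsto_atTop.1 he (ε / 2) (by positivity)
    refine ⟨N, fun k hk => ?_⟩
    rw [dist_comm, dist_eq_norm]
    refine lt_of_le_of_lt (ContinuousLinearMap.opNorm_le_bound _ (half_pos hε).le fun x => ?_)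
      (half_lt_self hε)
    refine b.norm_le_of_diagonal (e := fun m => if m < k then 0 else e m) (half_pos hε).le
      (fun m => ?_) fun m => ?_
    · split_ifs with h
      · simpa using (half_pos hε).le
      · simpa using (hN m (hk.trans (not_lt.1 h))).le
    · rw [_root_.sub_apply, inner_sub_right, hE, hFb]
      split_ifs <;> simp
  · rw [ContinuousLinearMap.isSelfAdjoint_iff_isSymmetric]
    intro x y
    change inner ℂ (E x) y = inner ℂ x (E y)
    rw [← b.tsum_inner_mul_inner, ← b.tsum_inner_mul_inner]
    congr 1
    funext n
    rw [hE, ← inner_conj_symm _ (b n), hE, map_mul, inner_conj_symm, Complex.conj_ofReal]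
    ring

theorem IsDiagonalModulo.wvnEquiv {A B : H →ₗ.[ℂ] H} {b b' : HilbertBasis ℕ ℂ H}
    {d d' : ℕ → ℝ} {K K' : H →L[ℂ] H} (hA : IsSelfAdjointOp A) (hB : IsSelfAdjointOp B)
    (hK : IsSelfAdjoint K) (hK' : IsSelfAdjoint K') (hKc : IsCompactOperator K)
    (hKc' : IsCompactOperator K') (h : IsDiagonalModulo A b d K)
    (h' : IsDiagonalModulo B b' d' K') (hd : Tendsto (fun n => d' n - d n) atTop (𝓝 0)) :
    WvNEquiv A B := by
  obtain ⟨E, hEc, hEs, hE⟩ := b'.exists_compact_diagonal hd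
  let u : H ≃ₗᵢ[ℂ] H := b.repr.trans b'.repr.symm
  have hu : ∀ x n, inner ℂ (b' n) (u x) = inner ℂ (b n) x := by
    intro x n
    rw [← b'.repr_apply_apply, ← b.repr_apply_apply]
    simp [u]
  let U : H →L[ℂ] H := (u.toContinuousLinearEquiv : H →L[ℂ] H)
  let V : H →L[ℂ] H := (u.symm.toContinuousLinearEquiv : H →L[ℂ] H)
  have hL : IsSelfAdjoint (U ∘L K ∘L V) := by
    rw [ContinuousLinearMap.isSelfAdjoint_iff_isSymmetric]
    intro x y
    change inner ℂ (u (K (u.symm x))) y = inner ℂ x (u (K (u.symm y)))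
    have h1 : inner ℂ (K (u.symm x)) (u.symm y) = inner ℂ (u.symm x) (K (u.symm y)) :=
      hK.isSymmetric _ _
    rwa [← u.inner_map_map (K _), ← u.inner_map_map (u.symm x), u.apply_symm_apply,
      u.apply_symm_apply] at h1
  have hdom : ∀ x, x ∈ A.domain ↔ u x ∈ B.domain := by
    intro x
    rw [h.mem_domain_iff hA hK, h'.mem_domain_iff hB hK']
    simp only [hu]
    have hEx : Memℓp (fun n => ((d' n - d n : ℝ) : ℂ) * inner ℂ (b n) x) 2 := by
      have h1 : (fun n => ((d' n - d n : ℝ) : ℂ) * inner ℂ (b n) x) = b'.repr (E (u x)) := by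
        funext n
        rw [b'.repr_apply_apply, hE, hu]
      rw [h1]
      exact lp.memℓp _
    constructor
    · intro hx
      refine (congrArg (Memℓp · 2) ?_).mpr (hx.add hEx)
      funext n
      simp only [Pi.add_apply]
      push_cast
      ring
    · intro hx
      refine (congrArg (Memℓp · 2) ?_).mpr (hx.sub hEx)
      funext n
      simp only [Pi.sub_apply]
      push_cast
      ring
  refine ⟨u, K' - U ∘L K ∘L V + E, ?_, (hK'.sub hL).add hEs, ?_, fun x hx => ?_⟩
  · exact (hKc'.sub ((hKc.comp_clm V).clm_comp U)).add hEc
  · ext y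
    rw [Submodule.mem_map]
    constructor
    · intro hy
      exact ⟨u.symm y, (hdom _).2 (by rwa [u.apply_symm_apply]), u.apply_symm_apply y⟩
    · rintro ⟨x, hx, rfl⟩
      exact (hdom x).1 hx
  · refine b'.ext_inner fun n => ?_
    have h1 := h.inner_apply hA hK x n
    have h2 := h'.inner_apply hB hK' ⟨u x, hx⟩ n
    have h3 : (K' - U ∘L K ∘L V + E) (u x) = K' (u x) - u (K x) + E (u x) := by
      change K' (u x) - u (K (u.symm (u x))) + E (u x) = _
      rw [u.symm_apply_apply]
    rw [inner_sub_right] at h1 h2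
    rw [h3, inner_add_right, inner_add_right, inner_sub_right, hE]
    simp only [hu] at h2 ⊢
    push_cast
    linear_combination h2 - h1

theorem HilbertBasis.exists_reindex (b : HilbertBasis ℕ ℂ H) (σ : ℕ ≃ ℕ) :
    ∃ c : HilbertBasis ℕ ℂ H, ∀ n, c n = b (σ n) := by
  refine ⟨HilbertBasis.mk (b.orthonormal.comp σ σ.injective) ?_, fun n =>
    congrFun (HilbertBasis.coe_mk _ _) n⟩
  rw [σ.surjective.range_comp]
  exact b.dense_span.ge

theorem NoLargeHoles.wvnEquiv [TopologicalSpace.SeparableSpace H]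
    (hdim : ¬ FiniteDimensional ℂ H) {M : Set ℝ} (hM : NoLargeHoles M) {A B : H →ₗ.[ℂ] H}
    (hA : IsSelfAdjointOp A) (hB : IsSelfAdjointOp B) (hAM : essSpec A = M)
    (hBM : essSpec B = M) : WvNEquiv A B := by
  obtain ⟨b, d, K, hKc, hK, h⟩ := hA.exists_diagonalization hdim
  obtain ⟨b', d', K', hKc', hK', h'⟩ := hB.exists_diagonalization hdim
  obtain ⟨σ, hσ⟩ := exists_equiv_tendsto_sub hM
    ((IsDiagonalModulo.essSpec_eq h hA hK hKc).symm.trans hAM)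
    ((IsDiagonalModulo.essSpec_eq h' hB hK' hKc').symm.trans hBM)
  obtain ⟨c, hc⟩ := b'.exists_reindex σ
  refine IsDiagonalModulo.wvnEquiv hA hB hK hK' hKc hKc' h (b' := c) (d' := d' ∘ σ)
    (fun n => ?_) hσ
  simp only [hc]
  exact h' (σ n)

end Equivalence

section LargeHoles

theorem exists_sequence_infinitely_near {M : Set ℝ} (hMc : IsClosed M) (hM : M.Nonempty) :
    ∃ a : ℕ → ℝ, (∀ n, a n ∈ M) ∧ {t | ∀ ε > 0, {n | |a n - t| < ε}.Infinite} = M := by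
  have : Nonempty M := hM.to_subtype
  let m : ℕ → M := TopologicalSpace.denseSeq M
  refine ⟨fun n => m n.unpair.1, fun n => (m _).2, Set.Subset.antisymm (fun t ht => ?_) ?_⟩
  · rw [← hMc.closure_eq, Metric.mem_closure_iff]
    intro ε hε
    obtain ⟨n, hn⟩ := (ht ε hε).nonempty
    exact ⟨_, (m n.unpair.1).2, by rw [dist_comm]; exact hn⟩
  · intro t ht ε hε
    obtain ⟨k, hk⟩ := (TopologicalSpace.denseRange_denseSeq M).exists_dist_lt (⟨t, ht⟩ : M) hε
    refine Set.infinite_of_injective_forall_mem (f := fun j => Nat.pair k j)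
      (fun i j hij => (Nat.pair_eq_pair.1 hij).2) fun j => ?_
    rw [dist_comm] at hk
    have hk' : |(m k : ℝ) - t| < ε := hk
    simpa using hk'

/-- Interleaving a sequence with one escaping to infinity does not change its cluster points. -/
theorem infinitely_near_interleave {a l : ℕ → ℝ} (hl : Tendsto (fun n => |l n|) atTop atTop) :
    {t | ∀ ε > 0, {n | |(if Even n then a (n / 2) else l (n / 2)) - t| < ε}.Infinite} =
      {t | ∀ ε > 0, {n | |a n - t| < ε}.Infinite} := by
  ext t
  refine forall₂_congr fun ε hε => ⟨fun h => ?_, fun h => ?_⟩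
  · by_contra hfin
    rw [Set.not_infinite] at hfin
    have hfin' : {n | |l n - t| < ε}.Finite := by
      rw [← Set.not_infinite, ← Nat.frequently_atTop_iff_infinite, not_frequently]
      filter_upwards [hl.eventually_ge_atTop (|t| + ε)] with n hn hlt
      have := abs_sub_abs_le_abs_sub (l n) t
      linarith
    refine h (((hfin.image fun n => 2 * n).union (hfin'.image fun n => 2 * n + 1)).subset ?_)
    intro n hn
    rw [Set.mem_ofPred_eq] at hn
    split_ifs at hn with he
    · exact Or.inl ⟨n / 2, hn, Nat.two_mul_div_two_of_even he⟩
    · exact Or.inr ⟨n / 2, hn, Nat.two_mul_div_two_add_one_of_odd (Nat.not_even_iff_odd.1 he)⟩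
  · refine (h.image (f := fun n => 2 * n) fun i _ j _ hij => by simpa using hij).mono ?_
    rintro _ ⟨n, hn, rfl⟩
    simpa using hn

variable {H : Type*} [NormedAddCommGroup H] [InnerProductSpace ℂ H]

theorem infDist_mul_norm_le_diagonalOp {M : Set ℝ} {a : ℕ → ℝ} (ha : ∀ n, a n ∈ M)
    (b : HilbertBasis ℕ ℂ H) (l : ℝ) (x : (diagonalOp b a).domain) :
    infDist l M * ‖(x : H)‖ ≤ ‖diagonalOp b a x - (l : ℂ) • (x : H)‖ := by
  rw [← sq_le_sq₀ (mul_nonneg infDist_nonneg (norm_nonneg _)) (norm_nonneg _), mul_pow]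
  refine hasSum_le (fun n => ?_) ((b.hasSum_norm_inner_sq (x : H)).mul_left _)
    (b.hasSum_norm_inner_sq _)
  have h1 : inner ℂ (b n) (diagonalOp b a x - (l : ℂ) • (x : H)) =
      ((a n - l : ℝ) : ℂ) * inner ℂ (b n) (x : H) := by
    rw [inner_sub_right, inner_diagonalOp, inner_smul_right]
    push_cast
    ring
  rw [h1, norm_mul, mul_pow, Complex.norm_real, Real.norm_eq_abs]
  gcongr
  · exact infDist_nonneg
  · rw [abs_sub_comm]
    exact infDist_le_dist_of_mem (ha n)

variable [CompleteSpace H]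

theorem isSelfAdjointOp_zero :
    IsSelfAdjointOp ((0 : H →L[ℂ] H).toPMap (⊤ : Submodule ℂ H)) := by
  have h : Dense ((⊤ : Submodule ℂ H) : Set H) := dense_univ
  refine ⟨h, ?_⟩
  rw [ContinuousLinearMap.toPMap_adjoint_eq_adjoint_toPMap_of_dense _ h, _root_.map_zero]

theorem essSpec_diagonalOp (b : HilbertBasis ℕ ℂ H) (d : ℕ → ℝ) :
    essSpec (diagonalOp b d) = {t | ∀ ε > 0, {n | |d n - t| < ε}.Infinite} :=
  (isDiagonalModulo_diagonalOp b d).essSpec_eq (isSelfAdjointOp_diagonalOp b d)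
    (IsSelfAdjoint.zero _) isCompactOperator_zero

theorem noLargeHoles_of_forall_wvnEquiv [TopologicalSpace.SeparableSpace H]
    (hdim : ¬ FiniteDimensional ℂ H) {M : Set ℝ} (hMc : IsClosed M) (hM : M.Nonempty)
    (h : ∀ A B : H →ₗ.[ℂ] H, IsSelfAdjointOp A → IsSelfAdjointOp B →
      essSpec A = M → essSpec B = M → WvNEquiv A B) : NoLargeHoles M := by
  refine ⟨hM, ?_⟩
  by_contra! hcon
  obtain ⟨ε, hε, hhole⟩ := hcon
  choose l hlM hlN hlε using fun n : ℕ => hhole (n + 1) n.cast_add_one_pos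
  have hl : Tendsto (fun n => |l n|) atTop atTop :=
    tendsto_atTop_mono (fun n => (lt_of_le_of_lt (by linarith) (hlN n)).le)
      tendsto_natCast_atTop_atTop
  obtain ⟨a, haM, ha⟩ := exists_sequence_infinitely_near hMc hM
  obtain ⟨b, -⟩ := (isSelfAdjointOp_zero (H := H)).exists_diagonalization hdim
  let c : ℕ → ℝ := fun n => if Even n then a (n / 2) else l (n / 2)
  obtain ⟨u, K, hKc, -, hdom, hu⟩ := h (diagonalOp b a) (diagonalOp b c)
    (isSelfAdjointOp_diagonalOp b a) (isSelfAdjointOp_diagonalOp b c)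
    ((essSpec_diagonalOp b a).trans ha)
    ((essSpec_diagonalOp b c).trans ((infinitely_near_interleave hl).trans ha))
  have hbound : ∀ n, ε ≤ ‖K (b (2 * n + 1))‖ := by
    intro n
    have hb := basis_mem_diagonalOp_domain b c (2 * n + 1)
    obtain ⟨x, hx, hxb⟩ : b (2 * n + 1) ∈ (diagonalOp b a).domain.map
      (u.toLinearEquiv : H →ₗ[ℂ] H) := hdom ▸ hb
    change u x = _ at hxb
    have hc : c (2 * n + 1) = l n := by
      have : ¬ Even (2 * n + 1) := by simp
      simp only [c, if_neg this]
      congr 1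
      lia
    have h1 := hu ⟨x, hx⟩ (by rw [hxb]; exact hb)
    simp only [hxb] at h1
    rw [diagonalOp_basis, hc, ← hxb, ← _root_.map_smul] at h1
    have h2 : u (diagonalOp b a ⟨x, hx⟩ - (l n : ℂ) • x) = -K (b (2 * n + 1)) := by
      rw [_root_.map_sub, h1, ← hxb]
      abel
    have h3 := infDist_mul_norm_le_diagonalOp haM b (l n) ⟨x, hx⟩
    have h4 : ‖x‖ = 1 := by rw [← u.norm_map, hxb, b.orthonormal.1]
    rw [← u.norm_map (_ - _), h2, norm_neg] at h3
    simp only [h4, mul_one] at h3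
    exact (hlε n).trans h3
  have hort : Orthonormal ℂ fun n => b (2 * n + 1) :=
    b.orthonormal.comp (fun n => 2 * n + 1) fun i j hij => by simpa using hij
  have hlim := (hKc.tendsto_zero_of_orthonormal hort).norm
  rw [norm_zero] at hlim
  exact hε.not_ge (ge_of_tendsto' hlim hbound)

end LargeHoles

theorem weyl_vonNeumann_characterization
    {H : Type*} [NormedAddCommGroup H] [InnerProductSpace ℂ H] [CompleteSpace H]
    [TopologicalSpace.SeparableSpace H] (hdim : ¬ FiniteDimensional ℂ H)
    (M : Set ℝ) (hMclosed : IsClosed M) (hMne : M.Nonempty) :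
    (∀ A B : H →ₗ.[ℂ] H, IsSelfAdjointOp A → IsSelfAdjointOp B →
        essSpec A = M → essSpec B = M → WvNEquiv A B) ↔ NoLargeHoles M := by
  exact ⟨noLargeHoles_of_forall_wvnEquiv hdim hMclosed hMne,
    fun h A B hA hB hAM hBM => h.wvnEquiv hdim hA hB hAM hBM⟩
end

section
/- Let M be a nonempty closed subset of ℝ that has large holes at infinity, i.e., there exists ε > 0 such that for every N > 0 there is λ ∈ ℝ∖M with |λ| > N and dist(λ, M) ≥ ε. Then there exist self-adjoint operators A, B on H with σ_ess(A) = σ_ess(B) = M that are NOT Weyl–von Neumann equivalent. -/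
open Filter Metric Topology LinearPMap

open scoped InnerProductSpace

/-- Bessel: an orthonormal sequence converges weakly to zero. -/
theorem Orthonormal.tendsto_inner_zero_s2 {E : Type*} [NormedAddCommGroup E] [InnerProductSpace ℂ E]
    {e : ℕ → E} (he : Orthonormal ℂ e) (x : E) :
    Tendsto (fun n => ⟪e n, x⟫_ℂ) atTop (𝓝 0) := by
  have h := (he.inner_products_summable (x := x)).tendsto_atTop_zero
  rw [tendsto_zero_iff_norm_tendsto_zero]
  simpa using h.sqrt

/-- A compact operator maps orthonormal sequences to sequences that are not bounded below. -/
theorem IsCompactOperator.not_forall_le_norm_orthonormal {E : Type*} [NormedAddCommGroup E]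
    [InnerProductSpace ℂ E] [CompleteSpace E] {K : E →L[ℂ] E} (hK : IsCompactOperator K)
    {e : ℕ → E} (he : Orthonormal ℂ e) {ε : ℝ} (hε : 0 < ε) : ¬ ∀ n, ε ≤ ‖K (e n)‖ := by
  intro h
  obtain ⟨y, -, φ, hφ, hy⟩ := (hK.isCompact_closure_image_closedBall 1).tendsto_subseq
    (x := fun n => K (e n))
    (fun n => subset_closure ⟨e n, by simp [he.1 n], rfl⟩)
  have h1 : Tendsto (fun n => ⟪K (e (φ n)), y⟫_ℂ) atTop (𝓝 ⟪y, y⟫_ℂ) :=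
    hy.inner tendsto_const_nhds
  have h2 : Tendsto (fun n => ⟪K (e (φ n)), y⟫_ℂ) atTop (𝓝 0) := by
    have := (he.tendsto_inner_zero_s2 (ContinuousLinearMap.adjoint K y)).comp hφ.tendsto_atTop
    simpa [Function.comp_def, ContinuousLinearMap.adjoint_inner_right] using this
  have hy0 : y = 0 := inner_self_eq_zero.1 (tendsto_nhds_unique h1 h2)
  have h3 : ε ≤ ‖y‖ := ge_of_tendsto' hy.norm fun n => h (φ n)
  rw [hy0, norm_zero] at h3
  exact absurd h3 (not_le.2 hε)

/-- In a separable space, every orthonormal family is countable. -/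
theorem Orthonormal.countable_of_separableSpace {ι E : Type*} [NormedAddCommGroup E]
    [InnerProductSpace ℂ E] [TopologicalSpace.SeparableSpace E] {v : ι → E}
    (hv : Orthonormal ℂ v) : Countable ι := by
  have hd : ∀ i j, i ≠ j → 1 ≤ dist (v i) (v j) := by
    intro i j hij
    have h := norm_sub_sq (𝕜 := ℂ) (v i) (v j)
    rw [hv.2 hij, hv.1 i, hv.1 j] at h
    rw [dist_eq_norm]
    norm_num at h
    nlinarith [norm_nonneg (v i - v j)]
  refine Set.countable_univ_iff.1 ?_
  refine Set.PairwiseDisjoint.countable_of_isOpen (s := fun i => ball (v i) (1 / 2)) ?_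
    (fun i _ => isOpen_ball) (fun i _ => ⟨v i, mem_ball_self (by norm_num)⟩)
  intro i _ j _ hij
  exact ball_disjoint_ball (by linarith [hd i j hij])

/-- A separable infinite-dimensional Hilbert space has a Hilbert basis indexed by `ℕ`. -/
theorem exists_hilbertBasis_nat {E : Type*} [NormedAddCommGroup E] [InnerProductSpace ℂ E]
    [CompleteSpace E] [TopologicalSpace.SeparableSpace E] (hdim : ¬ FiniteDimensional ℂ E) :
    Nonempty (HilbertBasis ℕ ℂ E) := by
  obtain ⟨w, b, -⟩ := exists_hilbertBasis ℂ E
  have hc : Countable w := b.orthonormal.countable_of_separableSpace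
  have hi : Infinite w := by
    by_contra hfin
    rw [not_infinite_iff_finite] at hfin
    have := Fintype.ofFinite w
    exact hdim b.toOrthonormalBasis.toBasis.finiteDimensional_of_finite
  obtain ⟨f⟩ := nonempty_equiv_of_countable (α := ℕ) (β := w)
  refine ⟨HilbertBasis.mk (v := b ∘ f) (b.orthonormal.comp f f.injective) ?_⟩
  rw [f.surjective.range_comp, b.dense_span]

namespace HilbertBasis

variable {ι : Type*} {E : Type*} [NormedAddCommGroup E] [InnerProductSpace ℂ E]

theorem ext_inner_left (b : HilbertBasis ι ℂ E) {x y : E}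
    (h : ∀ i, ⟪b i, x⟫_ℂ = ⟪b i, y⟫_ℂ) : x = y := by
  apply b.repr.injective
  ext i
  simpa only [b.repr_apply_apply] using h i

theorem hasSum_norm_inner_sq_s2 (b : HilbertBasis ι ℂ E) (x : E) :
    HasSum (fun i => ‖⟪b i, x⟫_ℂ‖ ^ 2) (‖x‖ ^ 2) := by
  have h := b.hasSum_inner_mul_inner x x
  have hx : ⟪x, x⟫_ℂ = ((‖x‖ ^ 2 : ℝ) : ℂ) := by
    simp
  have hi : ∀ i, ⟪x, b i⟫_ℂ * ⟪b i, x⟫_ℂ = ((‖⟪b i, x⟫_ℂ‖ ^ 2 : ℝ) : ℂ) := fun i => by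
    rw [← inner_conj_symm x, Complex.conj_mul', Complex.ofReal_pow]
  simpa only [hx, hi, Complex.hasSum_ofReal] using h

/-- The subspace of vectors that can be multiplied coordinatewise by the real family `a`. -/
def diagonalDomain (b : HilbertBasis ι ℂ E) (a : ι → ℝ) : Submodule ℂ E where
  carrier := {x | ∃ y, ∀ i, ⟪b i, y⟫_ℂ = a i * ⟪b i, x⟫_ℂ}
  zero_mem' := ⟨0, by simp⟩
  add_mem' := by
    rintro x x' ⟨y, hy⟩ ⟨y', hy'⟩
    exact ⟨y + y', fun i => by rw [inner_add_right, inner_add_right, hy, hy', mul_add]⟩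
  smul_mem' := by
    rintro c x ⟨y, hy⟩
    exact ⟨c • y, fun i => by rw [inner_smul_right, inner_smul_right, hy, mul_left_comm]⟩

/-- The maximal diagonal operator with real eigenvalues `a` along a Hilbert basis. -/
noncomputable def diagonal (b : HilbertBasis ι ℂ E) (a : ι → ℝ) : E →ₗ.[ℂ] E where
  domain := b.diagonalDomain a
  toFun :=
    { toFun := fun x => x.2.choose
      map_add' := fun x y => b.ext_inner_left fun i => by
        rw [inner_add_right, (x + y).2.choose_spec, x.2.choose_spec, y.2.choose_spec,
          Submodule.coe_add, inner_add_right, mul_add]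
      map_smul' := fun c x => b.ext_inner_left fun i => by
        rw [RingHom.id_apply, inner_smul_right, (c • x).2.choose_spec, x.2.choose_spec,
          Submodule.coe_smul, inner_smul_right, mul_left_comm] }

variable (b : HilbertBasis ι ℂ E) (a : ι → ℝ)

theorem mem_diagonal_domain {x : E} :
    x ∈ (b.diagonal a).domain ↔ ∃ y, ∀ i, ⟪b i, y⟫_ℂ = a i * ⟪b i, x⟫_ℂ :=
  Iff.rfl

theorem inner_diagonal (x : (b.diagonal a).domain) (i : ι) :
    ⟪b i, b.diagonal a x⟫_ℂ = a i * ⟪b i, (x : E)⟫_ℂ :=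
  x.2.choose_spec i

theorem inner_basis_smul (i j : ι) :
    ⟪b j, (a i : ℂ) • b i⟫_ℂ = a j * ⟪b j, b i⟫_ℂ := by
  rw [inner_smul_right]
  by_cases h : j = i
  · rw [h]
  · rw [b.orthonormal.2 h, mul_zero, mul_zero]

theorem basis_mem_diagonal_domain (i : ι) : b i ∈ (b.diagonal a).domain :=
  ⟨(a i : ℂ) • b i, b.inner_basis_smul a i⟩

theorem diagonal_basis (i : ι) (h : b i ∈ (b.diagonal a).domain) :
    b.diagonal a ⟨b i, h⟩ = (a i : ℂ) • b i :=
  b.ext_inner_left fun j => by rw [b.inner_diagonal, b.inner_basis_smul]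

theorem dense_diagonal_domain : Dense ((b.diagonal a).domain : Set E) := by
  rw [Submodule.dense_iff_topologicalClosure_eq_top, eq_top_iff, ← b.dense_span]
  refine Submodule.topologicalClosure_mono (Submodule.span_le.2 ?_)
  rintro _ ⟨i, rfl⟩
  exact b.basis_mem_diagonal_domain a i

theorem diagonal_isFormalAdjoint : (b.diagonal a).IsFormalAdjoint (b.diagonal a) := by
  intro x y
  rw [← b.tsum_inner_mul_inner, ← b.tsum_inner_mul_inner (x : E)]
  congr 1
  ext i
  rw [b.inner_diagonal, ← inner_conj_symm, b.inner_diagonal, map_mul, Complex.conj_ofReal,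
    inner_conj_symm]
  ring

theorem adjoint_diagonal [CompleteSpace E] : (b.diagonal a).adjoint = b.diagonal a := by
  have hd := b.dense_diagonal_domain a
  have hle := (b.diagonal_isFormalAdjoint a).le_adjoint hd
  refine (LinearPMap.eq_of_le_of_domain_eq hle (le_antisymm hle.1 fun y hy => ?_)).symm
  refine ⟨(b.diagonal a).adjoint ⟨y, hy⟩, fun i => ?_⟩
  have h := adjoint_isFormalAdjoint hd ⟨y, hy⟩ ⟨b i, b.basis_mem_diagonal_domain a i⟩
  rw [b.diagonal_basis, inner_smul_right] at h
  rw [← inner_conj_symm, h, map_mul, Complex.conj_ofReal, inner_conj_symm]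

/-- If `a` stays at distance `δ` from `t` outside a finite set, then `b.diagonal a - t` is bounded
below up to finitely many coordinates. -/
theorem le_norm_diagonal_sub_sq {t δ : ℝ} (hδ : 0 ≤ δ) (F : Finset ι)
    (hF : ∀ i ∉ F, δ ≤ |a i - t|) (x : (b.diagonal a).domain) :
    δ ^ 2 * (‖(x : E)‖ ^ 2 - ∑ i ∈ F, ‖⟪b i, (x : E)⟫_ℂ‖ ^ 2) ≤
      ‖b.diagonal a x - (t : ℂ) • (x : E)‖ ^ 2 := by
  classical
  have h1 := b.hasSum_norm_inner_sq_s2 (x : E)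
  have h2 := b.hasSum_norm_inner_sq_s2 (b.diagonal a x - (t : ℂ) • (x : E))
  have h3 := hasSum_sum_of_ne_finset_zero (s := F) (L := .unconditional ι)
    (f := fun i => if i ∈ F then ‖⟪b i, (x : E)⟫_ℂ‖ ^ 2 else 0) (by simp +contextual)
  rw [Finset.sum_congr rfl (g := fun i => ‖⟪b i, (x : E)⟫_ℂ‖ ^ 2)
    (fun i hi => if_pos hi)] at h3
  refine hasSum_le (fun i => ?_) ((h1.sub h3).mul_left (δ ^ 2)) h2
  by_cases hi : i ∈ F
  · simp [hi]
  · have : ⟪b i, b.diagonal a x - (t : ℂ) • (x : E)⟫_ℂ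
        = ((a i - t : ℝ) : ℂ) * ⟪b i, (x : E)⟫_ℂ := by
      rw [inner_sub_right, b.inner_diagonal, inner_smul_right]
      push_cast
      ring
    rw [if_neg hi, sub_zero, this, norm_mul, mul_pow, Complex.norm_real, Real.norm_eq_abs]
    gcongr
    exact hF i hi

end HilbertBasis

section DiagonalEssSpec

variable {E : Type*} [NormedAddCommGroup E] [InnerProductSpace ℂ E] (b : HilbertBasis ℕ ℂ E)
  (a : ℕ → ℝ)

theorem mem_essSpec_diagonal {t : ℝ} (h : ∀ δ > 0, {n | |a n - t| < δ}.Infinite) :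
    t ∈ essSpec (b.diagonal a) := by
  obtain ⟨φ, hφ, hφt⟩ := extraction_forall_of_frequently
    (P := fun k n => |a n - t| < 1 / ((k : ℝ) + 1))
    fun k => Nat.frequently_atTop_iff_infinite.2 (h _ (by positivity))
  refine ⟨fun k => ⟨b (φ k), b.basis_mem_diagonal_domain a _⟩,
    b.orthonormal.comp φ hφ.injective, ?_⟩
  refine squeeze_zero (fun _ => norm_nonneg _) (fun k => ?_)
    tendsto_one_div_add_atTop_nhds_zero_nat
  rw [b.diagonal_basis, ← sub_smul, norm_smul, b.orthonormal.1, mul_one, ← Complex.ofReal_sub,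
    Complex.norm_real]
  exact (hφt k).le

theorem notMem_essSpec_diagonal {t δ : ℝ} (hδ : 0 < δ) (h : {n | |a n - t| < δ}.Finite) :
    t ∉ essSpec (b.diagonal a) := by
  rintro ⟨x, hx, hlim⟩
  have hF : ∀ n ∉ h.toFinset, δ ≤ |a n - t| := fun n hn => by simpa using hn
  have h1 : Tendsto (fun k => δ ^ 2 * (‖(x k : E)‖ ^ 2 -
      ∑ i ∈ h.toFinset, ‖⟪b i, (x k : E)⟫_ℂ‖ ^ 2)) atTop (𝓝 (δ ^ 2 * (1 ^ 2 -
      ∑ i ∈ h.toFinset, 0 ^ 2))) := by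
    refine (Tendsto.sub ?_ (tendsto_finsetSum _ fun i _ => Tendsto.pow ?_ 2)).const_mul _
    · simp only [hx.1]
      exact tendsto_const_nhds
    · simpa only [norm_inner_symm, norm_zero] using (hx.tendsto_inner_zero_s2 (b i)).norm
  have h2 := le_of_tendsto_of_tendsto' h1 (hlim.pow 2)
    fun k => b.le_norm_diagonal_sub_sq a hδ.le _ hF (x k)
  have : 0 < δ ^ 2 := by positivity
  norm_num at h2
  linarith

/-- A diagonal operator whose eigenvalues visit every neighbourhood of every point of the closed
set `M` infinitely often, and every bounded set off `M` finitely often, has essential spectrum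
`M`. -/
theorem essSpec_diagonal_eq {M : Set ℝ} (hM : IsClosed M)
    (hin : ∀ t ∈ M, ∀ δ > 0, {n | |a n - t| < δ}.Infinite)
    (hout : ∀ r, {n | a n ∉ M ∧ |a n| < r}.Finite) : essSpec (b.diagonal a) = M := by
  ext t
  refine ⟨fun ht => ?_, fun ht => mem_essSpec_diagonal b a (hin t ht)⟩
  by_contra htM
  obtain ⟨δ, hδ, hball⟩ := Metric.isOpen_iff.1 hM.isOpen_compl t htM
  refine notMem_essSpec_diagonal b a hδ ((hout (|t| + δ)).subset fun n hn => ?_) ht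
  rw [Set.mem_ofPred_eq] at hn
  refine ⟨hball (by rwa [mem_ball, Real.dist_eq]), ?_⟩
  have := abs_add_le (a n - t) t
  rw [sub_add_cancel] at this
  linarith

/-- If infinitely many of the eigenvalues `c` stay at distance `ε` from all the eigenvalues `a`,
the two diagonal operators are not Weyl–von Neumann equivalent. -/
theorem not_wvNEquiv_diagonal [CompleteSpace E] {c : ℕ → ℝ} {φ : ℕ → ℕ}
    (hφ : Function.Injective φ) {ε : ℝ} (hε : 0 < ε) (h : ∀ k n, ε ≤ |a n - c (φ k)|) :
    ¬ WvNEquiv (b.diagonal a) (b.diagonal c) := by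
  rintro ⟨u, K, hK, -, hdom, hu⟩
  refine hK.not_forall_le_norm_orthonormal (b.orthonormal.comp φ hφ) hε fun k => ?_
  have hmem := b.basis_mem_diagonal_domain c (φ k)
  obtain ⟨x, hx, hxb⟩ := Submodule.mem_map.1 (hdom ▸ hmem)
  replace hxb : u x = b (φ k) := hxb
  have hx1 : ‖x‖ = 1 := by rw [← u.norm_map, hxb, b.orthonormal.1]
  have key := hu ⟨x, hx⟩ (by rw [hxb]; exact hmem)
  simp only [hxb] at key
  rw [b.diagonal_basis, ← hxb, ← u.map_smul, ← sub_eq_iff_eq_add', ← u.map_sub] at key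
  have hb := b.le_norm_diagonal_sub_sq a hε.le ∅ (fun n _ => h k n) ⟨x, hx⟩
  rw [Finset.sum_empty, sub_zero, hx1, one_pow, mul_one] at hb
  rw [Function.comp_apply, ← hxb, ← key, u.norm_map, norm_sub_rev]
  exact le_of_sq_le_sq hb (norm_nonneg _)

end DiagonalEssSpec

/-- A nonempty set of reals contains a sequence visiting every neighbourhood of each of its points
infinitely often. -/
theorem exists_seq_infinite_visits {M : Set ℝ} (hM : M.Nonempty) :
    ∃ a : ℕ → ℝ, (∀ n, a n ∈ M) ∧ ∀ t ∈ M, ∀ δ > 0, {n | |a n - t| < δ}.Infinite := by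
  have : Nonempty M := hM.to_subtype
  refine ⟨fun n => TopologicalSpace.denseSeq M n.unpair.1, fun n => Subtype.prop _, ?_⟩
  intro t ht δ hδ
  obtain ⟨i, hi⟩ := (TopologicalSpace.denseRange_denseSeq M).exists_dist_lt ⟨t, ht⟩ hδ
  refine Set.infinite_of_injective_forall_mem (f := fun j => Nat.pair i j) ?_ fun j => ?_
  · intro j j' hj
    exact (Nat.pair_eq_pair.1 hj).2
  · rw [dist_comm, Subtype.dist_eq, Real.dist_eq] at hi
    simpa using hi

theorem exists_not_weylVonNeumannEquiv_of_largeHoles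
    {H : Type*} [NormedAddCommGroup H] [InnerProductSpace ℂ H] [CompleteSpace H]
    [TopologicalSpace.SeparableSpace H] (hdim : ¬ FiniteDimensional ℂ H)
    (M : Set ℝ) (hMclosed : IsClosed M) (hMne : M.Nonempty)
    (hM : ∃ ε > 0, ∀ N > 0, ∃ l : ℝ, l ∉ M ∧ |l| > N ∧ ε ≤ infDist l M) :
    ∃ A B : H →ₗ.[ℂ] H, IsSelfAdjointOp A ∧ IsSelfAdjointOp B ∧
      essSpec A = M ∧ essSpec B = M ∧ ¬ WvNEquiv A B := by
  obtain ⟨b⟩ := exists_hilbertBasis_nat hdim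
  obtain ⟨ε, hε, hM⟩ := hM
  choose l hlM hlN hlε using fun n : ℕ => hM (n + 1) (by positivity)
  obtain ⟨a, haM, hain⟩ := exists_seq_infinite_visits hMne
  let c : ℕ → ℝ := fun n => if Even n then a (n / 2) else l (n / 2)
  have hc_even : ∀ n, c (2 * n) = a n := fun n => by simp [c]
  have hc_odd : ∀ n, c (2 * n + 1) = l n := fun n => by
    have : (2 * n + 1) / 2 = n := by omega
    simp [c, this]
  refine ⟨b.diagonal a, b.diagonal c, ⟨b.dense_diagonal_domain a, b.adjoint_diagonal a⟩,
    ⟨b.dense_diagonal_domain c, b.adjoint_diagonal c⟩,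
    essSpec_diagonal_eq b a hMclosed hain fun r => ?_,
    essSpec_diagonal_eq b c hMclosed (fun t ht δ hδ => ?_) fun r => ?_,
    not_wvNEquiv_diagonal b a (φ := fun k => 2 * k + 1) (fun _ _ hk => by simpa using hk) hε
      fun k n => ?_⟩
  · convert Set.finite_empty
    ext n
    simp [haM n]
  · refine ((hain t ht δ hδ).image (f := fun n => 2 * n)
      (fun _ _ _ _ hk => by simpa using hk)).mono ?_
    rintro _ ⟨n, hn, rfl⟩
    simpa only [Set.mem_ofPred_eq, hc_even] using hn
  · refine (Set.finite_lt_nat (2 * ⌈r⌉₊ + 1)).subset fun n hn => ?_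
    obtain ⟨hnM, hnr⟩ := hn
    obtain ⟨k, rfl | rfl⟩ := n.even_or_odd'
    · rw [hc_even] at hnM
      exact absurd (haM k) hnM
    · rw [hc_odd] at hnr
      have h1 : (k : ℝ) < ⌈r⌉₊ := by linarith [hlN k, Nat.le_ceil r]
      have h2 : k < ⌈r⌉₊ := by exact_mod_cast h1
      show 2 * k + 1 < 2 * ⌈r⌉₊ + 1
      omega
  · rw [hc_odd, abs_sub_comm, ← Real.dist_eq]
    exact (hlε k).trans (infDist_le_dist_of_mem (haM n))
end

section
/- Let M be a nonempty closed subset of ℝ having no large holes at infinity, and let (λ_n) be a real sequence whose set of accumulation points equals M. Then dist(λ_n, M) → 0 as n → ∞. -/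
open Filter Metric Topology

noncomputable section

/-- The set of accumulation points of a real sequence: limits of convergent subsequences. -/
def accPts (a : ℕ → ℝ) : Set ℝ :=
  {t | ∃ φ : ℕ → ℕ, StrictMono φ ∧ Tendsto (a ∘ φ) atTop (𝓝 t)}

end
theorem tendsto_infDist_of_noLargeHoles
    (M : Set ℝ) (hMclosed : IsClosed M) (hMne : M.Nonempty) (hM : NoLargeHoles M)
    (l : ℕ → ℝ) (hacc : accPts l = M) :
    Tendsto (fun n => infDist (l n) M) atTop (𝓝 0) := by
  refine Metric.tendsto_atTop.2 fun ε hε => ?_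
  by_contra! hfar
  obtain ⟨N, -, hN⟩ := hM.2 ε hε
  have hfreq : ∃ᶠ n in atTop, l n ∈ closedBall 0 N ∩ {x | ε ≤ infDist x M} := by
    refine frequently_atTop.2 fun k => ?_
    obtain ⟨n, hkn, hn⟩ := hfar k
    rw [Real.dist_0_eq_abs, abs_of_nonneg infDist_nonneg] at hn
    refine ⟨n, hkn, ?_, hn⟩
    rw [mem_closedBall, Real.dist_0_eq_abs]
    by_contra! hlarge
    have hnot : l n ∉ M := fun hmem => by
      rw [infDist_zero_of_mem hmem] at hn
      exact hn.not_gt hε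
    exact hn.not_gt (hN _ hnot hlarge)
  have hclosed : IsClosed {x : ℝ | ε ≤ infDist x M} :=
    isClosed_le continuous_const (continuous_infDist_pt M)
  obtain ⟨t, ht, φ, hφ, hlim⟩ :=
    ((isCompact_closedBall 0 N).inter_right hclosed).tendsto_subseq' hfreq
  have htM : t ∈ M := hacc ▸ ⟨φ, hφ, hlim⟩
  have hεt : ε ≤ infDist t M := ht.2
  rw [infDist_zero_of_mem htM] at hεt
  exact hεt.not_gt hε
end

section
/- Let M be a nonempty closed subset of ℝ, and let (λ_n) and (μ_n) be real sequences such that the set of accumulation points of each sequence equals M, and dist(λ_n, M) → 0 and dist(μ_n, M) → 0 as n → ∞. Then there exists a bijection π : ℕ → ℕ such that |λ_{π(n)} − μ_n| → 0 as n → ∞. -/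
open Filter Metric Topology

/-- If every point of `M` is an accumulation point of `b`, then the terms of `a` can be matched
injectively with terms of `b`, with errors barely larger than the distances to `M`. -/
theorem exists_strictMono_abs_sub_lt {M : Set ℝ} (hM : M.Nonempty) (a b : ℕ → ℝ)
    (hb : M ⊆ accPts b) :
    ∃ φ : ℕ → ℕ, StrictMono φ ∧
      ∀ n, |a n - b (φ n)| < infDist (a n) M + 2 * (1 / ((n : ℝ) + 1)) := by
  refine extraction_forall_of_frequently
    (P := fun n k => |a n - b k| < infDist (a n) M + 2 * (1 / ((n : ℝ) + 1))) fun n => ?_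
  have hpos : 0 < 1 / ((n : ℝ) + 1) := Nat.one_div_pos_of_nat
  obtain ⟨t, ht, hat⟩ := (infDist_lt_iff hM).1 (lt_add_of_pos_right (infDist (a n) M) hpos)
  obtain ⟨ψ, hψ, hlim⟩ := hb ht
  refine hψ.tendsto_atTop.frequently (Eventually.frequently ?_)
  filter_upwards [hlim.eventually (ball_mem_nhds t hpos)] with k hk
  have h := dist_triangle_right (a n) (b (ψ k)) t
  rw [Function.comp_apply] at hk
  rw [← Real.dist_eq]
  linarith

theorem exists_bijection_of_infDist_tendsto_zero
    (M : Set ℝ) (hMclosed : IsClosed M) (hMne : M.Nonempty)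
    (l m : ℕ → ℝ) (haccl : accPts l = M) (haccm : accPts m = M)
    (hl : Tendsto (fun n => infDist (l n) M) atTop (𝓝 0))
    (hm : Tendsto (fun n => infDist (m n) M) atTop (𝓝 0)) :
    ∃ π : ℕ → ℕ, Function.Bijective π ∧
      Tendsto (fun n => |l (π n) - m n|) atTop (𝓝 0) := by
  obtain ⟨f, hf, hf_lt⟩ := exists_strictMono_abs_sub_lt hMne m l haccl.ge
  obtain ⟨g, hg, hg_lt⟩ := exists_strictMono_abs_sub_lt hMne l m haccm.ge
  have he : ∀ a : ℕ → ℝ, Tendsto (fun n => infDist (a n) M) atTop (𝓝 0) →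
      Tendsto (fun n : ℕ => infDist (a n) M + 2 * (1 / ((n : ℝ) + 1))) atTop (𝓝 0) :=
    fun a ha => by
      simpa using ha.add ((tendsto_one_div_add_atTop_nhds_zero_nat (𝕜 := ℝ)).const_mul 2)
  have he_nonneg : ∀ (a : ℕ → ℝ) (n : ℕ), 0 ≤ infDist (a n) M + 2 * (1 / ((n : ℝ) + 1)) :=
    fun a n => add_nonneg infDist_nonneg (by positivity)
  obtain ⟨π, hπ, hR⟩ := Function.Embedding.schroeder_bernstein_of_rel hf.injective hg.injective
    (fun n k => |l k - m n| ≤ (infDist (l k) M + 2 * (1 / ((k : ℝ) + 1))) +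
      (infDist (m n) M + 2 * (1 / ((n : ℝ) + 1))))
    (fun n => by
      rw [abs_sub_comm]
      exact (hf_lt n).le.trans (le_add_of_nonneg_left (he_nonneg l (f n))))
    (fun k => (hg_lt k).le.trans (le_add_of_nonneg_right (he_nonneg m (g k))))
  refine ⟨π, hπ, squeeze_zero (fun n => abs_nonneg _) hR ?_⟩
  simpa only [Function.comp_apply, add_zero] using
    ((he l hl).comp hπ.injective.nat_tendsto_atTop).add (he m hm)
end

section
/- Let M be a nonempty closed subset of ℝ having no large holes at infinity, and let (λ_n) and (μ_n) be real sequences whose sets of accumulation points both equal M. Then there exists a bijection π : ℕ → ℕ such that |λ_{π(n)} − μ_n| → 0 as n → ∞. -/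
open Filter Metric Topology

/-- A sequence whose accumulation points form a set without large holes approaches that set. -/
theorem tendsto_infDist_accPts (a : ℕ → ℝ) (hM : NoLargeHoles (accPts a)) :
    Tendsto (fun n => infDist (a n) (accPts a)) atTop (𝓝 0) := by
  rw [Metric.tendsto_atTop']
  by_contra! h
  obtain ⟨ε, hε, h⟩ := h
  obtain ⟨N, -, hN⟩ := hM.2 ε hε
  have hs : IsCompact (closedBall (0 : ℝ) N ∩ {x | ε ≤ infDist x (accPts a)}) :=
    (isCompact_closedBall 0 N).inter_right
      (isClosed_le continuous_const (continuous_infDist_pt _))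
  have hfreq : ∃ᶠ n in atTop,
      a n ∈ closedBall (0 : ℝ) N ∩ {x | ε ≤ infDist x (accPts a)} := by
    rw [frequently_atTop]
    intro k
    obtain ⟨n, hn, hd⟩ := h k
    rw [Real.dist_eq, sub_zero, abs_of_nonneg infDist_nonneg] at hd
    refine ⟨n, hn.le, ?_, hd⟩
    rw [mem_closedBall, Real.dist_eq, sub_zero]
    by_contra! hgt
    refine (hN (a n) (fun hmem => ?_) hgt).not_ge hd
    rw [infDist_zero_of_mem hmem] at hd
    exact hd.not_gt hε
  obtain ⟨t, ht, φ, hφ, hlim⟩ := hs.tendsto_subseq' hfreq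
  have h0 : infDist t (accPts a) = 0 := infDist_zero_of_mem ⟨φ, hφ, hlim⟩
  exact (h0 ▸ ht.2 : ε ≤ 0).not_gt hε

/-- Every point is within any bound exceeding its distance to the accumulation points of a sequence
from infinitely many terms of that sequence. -/
theorem frequently_dist_lt_of_infDist_accPts_lt {a : ℕ → ℝ} (hne : (accPts a).Nonempty) {x r : ℝ}
    (h : infDist x (accPts a) < r) : ∃ᶠ k in atTop, |a k - x| < r := by
  obtain ⟨t, ⟨φ, hφ, hlim⟩, ht⟩ := (infDist_lt_iff hne).1 h
  have hball : ball x r ∈ 𝓝 t := isOpen_ball.mem_nhds (by rwa [mem_ball, dist_comm])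
  exact hφ.tendsto_atTop.frequently (hlim.eventually hball).frequently

theorem exists_bijection_of_noLargeHoles
    (M : Set ℝ) (hMclosed : IsClosed M) (hMne : M.Nonempty) (hM : NoLargeHoles M)
    (l m : ℕ → ℝ) (haccl : accPts l = M) (haccm : accPts m = M) :
    ∃ π : ℕ → ℕ, Function.Bijective π ∧
      Tendsto (fun n => |l (π n) - m n|) atTop (𝓝 0) := by
  have hδ {a : ℕ → ℝ} (ha : accPts a = M) :
      Tendsto (fun n : ℕ => infDist (a n) M + 1 / ((n : ℝ) + 1)) atTop (𝓝 0) := by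
    subst ha
    simpa using (tendsto_infDist_accPts a hM).add tendsto_one_div_add_atTop_nhds_zero_nat
  have hinj {a b : ℕ → ℝ} (ha : accPts a = M) : ∃ f : ℕ → ℕ, StrictMono f ∧
      ∀ n, |a (f n) - b n| < infDist (b n) M + 1 / ((n : ℝ) + 1) := by
    subst ha
    exact Filter.extraction_forall_of_frequently fun n =>
      frequently_dist_lt_of_infDist_accPts_lt hMne (lt_add_of_pos_right _ Nat.one_div_pos_of_nat)
  obtain ⟨f, hf, hfd⟩ := hinj (b := m) haccl
  obtain ⟨g, hg, hgd⟩ := hinj (b := l) haccm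
  obtain ⟨π, hπ, hR⟩ := Function.Embedding.schroeder_bernstein_of_rel hf.injective hg.injective
    (fun n j => |l j - m n| ≤ max (infDist (m n) M + 1 / ((n : ℝ) + 1))
      (infDist (l j) M + 1 / ((j : ℝ) + 1)))
    (fun n => (hfd n).le.trans (le_max_left _ _))
    (fun j => by rw [abs_sub_comm]; exact (hgd j).le.trans (le_max_right _ _))
  refine ⟨π, hπ, squeeze_zero (fun _ => abs_nonneg _) hR ?_⟩
  simpa using (hδ haccm).max ((hδ haccl).comp hπ.injective.nat_tendsto_atTop)
end
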